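/- arXiv:2109.09024 — 6 statements merged into one kernel-verified Lean document; each statement's English description precedes it below -/
import Mathlib

section
/- Let p > 1 and a > 1, and let f(v) = |v|^{p-1} v / (log(2 + v^2))^a. Then there exist t₀ > 0 and a C² function φ₀ : [-t₀, 0) → (0, ∞) such that φ₀''(t) = φ₀(t)^p + f(φ₀(t)) for all t ∈ [-t₀, 0), and (-t)^{2/(p-1)} · φ₀(t) → κ₀ as t → 0⁻ (in particular φ₀ blows up at time 0). -/
open Filter Set

/-- The strong perturbation `f(v) = |v|^{p-1} v / (log(2+v^2))^a`. -/
noncomputable def f (p a v : ℝ) : ℝ := |v| ^ (p - 1) * v / Real.log (2 + v ^ 2) ^ a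

/-- The constant `κ₀ = (2(p+1)/(p-1)^2)^{1/(p-1)}`. -/
noncomputable def kappa0 (p : ℝ) : ℝ := (2 * (p + 1) / (p - 1) ^ 2) ^ (1 / (p - 1))

open Topology MeasureTheory intervalIntegral

/-- Scalar autonomous equations `w' = K(w)` with continuous, positive, bounded right-hand side
have a global solution through the origin. -/
theorem exists_global_solution_of_continuous_pos_bounded {K : ℝ → ℝ} (hK : Continuous K)
    (hpos : ∀ x, 0 < K x) {C : ℝ} (hC : ∀ x, K x ≤ C) :
    ∃ w : ℝ → ℝ, w 0 = 0 ∧ ∀ s, HasDerivAt w (K (w s)) s := by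
  have hCpos : 0 < C := (hpos 0).trans_le (hC 0)
  have hJ : Continuous fun x => (K x)⁻¹ := hK.inv₀ fun x => (hpos x).ne'
  set S : ℝ → ℝ := fun x => ∫ y in (0 : ℝ)..x, (K y)⁻¹ with hS
  have hS0 : S 0 = 0 := by simp [hS]
  have hSd : ∀ x, HasDerivAt S (K x)⁻¹ x := fun x => hJ.integral_hasStrictDerivAt 0 x |>.hasDerivAt
  have hScont : Continuous S := continuous_iff_continuousAt.2 fun x => (hSd x).continuousAt
  have hSmono : StrictMono S := strictMono_of_hasDerivAt_pos hSd fun x => inv_pos.2 (hpos x)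
  have hlin : Monotone fun x => S x - C⁻¹ * x := by
    refine monotone_of_hasDerivAt_nonneg (f' := fun x => (K x)⁻¹ - C⁻¹) (fun x => ?_) fun x => ?_
    · simpa using (hSd x).fun_sub ((hasDerivAt_id x).const_mul C⁻¹)
    · exact sub_nonneg.2 (inv_anti₀ (hpos x) (hC x))
  have htop : Tendsto S atTop atTop := by
    refine tendsto_atTop_mono' _ ?_ (tendsto_id.const_mul_atTop (inv_pos.2 hCpos))
    filter_upwards [eventually_ge_atTop 0] with x hx
    have := hlin hx
    simp only [hS0, mul_zero, sub_zero] at this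
    simp only [id]; linarith
  have hbot : Tendsto S atBot atBot := by
    refine tendsto_atBot_mono' _ ?_ (tendsto_id.const_mul_atBot (inv_pos.2 hCpos))
    filter_upwards [eventually_le_atBot 0] with x hx
    have := hlin hx
    simp only [hS0, mul_zero, sub_zero] at this
    simp only [id]; linarith
  let e := hSmono.orderIsoOfSurjective S (hScont.surjective htop hbot)
  have he : ∀ y, S (e.symm y) = y := fun y => e.apply_symm_apply y
  refine ⟨e.symm, hSmono.injective (by rw [he, hS0]), fun s => ?_⟩
  simpa using HasDerivAt.of_local_left_inverse (e.symm.continuous.continuousAt)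
    (hSd (e.symm s)) (inv_pos.2 (hpos _)).ne' (Eventually.of_forall he)

/-- The normalized primitive `v^{-(p+1)} ∫₀ᵛ u^p (1 + ε u) du`, written on the unit interval. -/
noncomputable def scaledPrimitive (p : ℝ) (ε : ℝ → ℝ) (v : ℝ) : ℝ :=
  ∫ s in (0 : ℝ)..1, s ^ p * (1 + ε (s * v))

theorem continuous_scaledPrimitive {p : ℝ} (hp : 0 < p) {ε : ℝ → ℝ} (hε : Continuous ε) :
    Continuous (scaledPrimitive p ε) := by
  refine continuous_parametric_intervalIntegral_of_continuous' ?_ 0 1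
  have : Continuous fun z : ℝ × ℝ => z.2 ^ p := continuous_snd.rpow_const fun _ => Or.inr hp.le
  unfold Function.uncurry
  fun_prop

theorem integral_zero_one_rpow {p : ℝ} (hp : 0 < p) : ∫ s in (0 : ℝ)..1, s ^ p = 1 / (p + 1) := by
  rw [integral_rpow (Or.inl (by linarith))]
  simp [Real.zero_rpow (by linarith : p + 1 ≠ 0)]

theorem scaledPrimitive_mem_Icc {p : ℝ} (hp : 0 < p) {ε : ℝ → ℝ} (hε : Continuous ε)
    (h0 : ∀ u, 0 ≤ ε u) {B : ℝ} (hB : ∀ u, ε u ≤ B) (v : ℝ) :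
    scaledPrimitive p ε v ∈ Icc (1 / (p + 1)) (1 / (p + 1) * (1 + B)) := by
  have hpow : Continuous fun s : ℝ => s ^ p := continuous_id.rpow_const fun _ => Or.inr hp.le
  have hint : Continuous fun s : ℝ => s ^ p * (1 + ε (s * v)) := by fun_prop
  rw [← integral_zero_one_rpow hp, ← intervalIntegral.integral_mul_const]
  constructor
  · refine integral_mono_on zero_le_one (hpow.intervalIntegrable _ _)
      (hint.intervalIntegrable _ _) fun s hs => ?_
    nlinarith [mul_nonneg (Real.rpow_nonneg hs.1 p) (h0 (s * v))]
  · refine integral_mono_on zero_le_one (hint.intervalIntegrable _ _)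
      ((hpow.mul continuous_const).intervalIntegrable _ _) fun s hs => ?_
    exact mul_le_mul_of_nonneg_left (by linarith [hB (s * v)]) (Real.rpow_nonneg hs.1 p)

theorem tendsto_scaledPrimitive_atTop {p : ℝ} (hp : 0 < p) {ε : ℝ → ℝ} (hε : Continuous ε)
    (h0 : ∀ u, 0 ≤ ε u) {B : ℝ} (hB : ∀ u, ε u ≤ B) (hlim : Tendsto ε atTop (𝓝 0)) :
    Tendsto (scaledPrimitive p ε) atTop (𝓝 (1 / (p + 1))) := by
  have hpow : Continuous fun s : ℝ => s ^ p := continuous_id.rpow_const fun _ => Or.inr hp.le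
  rw [← integral_zero_one_rpow hp]
  refine tendsto_integral_filter_of_dominated_convergence (fun _ => 1 + B)
    (Eventually.of_forall fun v => ?_) (Eventually.of_forall fun v => ?_)
    intervalIntegrable_const ?_
  · exact Continuous.aestronglyMeasurable (by fun_prop)
  · refine Eventually.of_forall fun s hs => ?_
    rw [uIoc_of_le zero_le_one] at hs
    have h1 := Real.rpow_le_one hs.1.le hs.2 hp.le
    have h2 := Real.rpow_nonneg hs.1.le p
    rw [Real.norm_of_nonneg (mul_nonneg h2 (by linarith [h0 (s * v)]))]
    exact (mul_le_of_le_one_left (by linarith [h0 (s * v)]) h1).trans (by linarith [hB (s * v)])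
  · refine Eventually.of_forall fun s hs => ?_
    rw [uIoc_of_le zero_le_one] at hs
    have := (hlim.comp (tendsto_id.const_mul_atTop hs.1)).const_add 1 |>.const_mul (s ^ p)
    simpa using this

theorem integral_eq_rpow_mul_scaledPrimitive (p : ℝ) (ε : ℝ → ℝ) {v : ℝ} (hv : 0 < v) :
    ∫ u in (0 : ℝ)..v, u ^ p * (1 + ε u) = v ^ (p + 1) * scaledPrimitive p ε v := by
  have h := intervalIntegral.integral_comp_mul_right (a := 0) (b := 1)
    (fun u => u ^ p * (1 + ε u)) hv.ne'
  have h2 : ∫ s in (0 : ℝ)..1, (s * v) ^ p * (1 + ε (s * v)) = v ^ p * scaledPrimitive p ε v := by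
    rw [scaledPrimitive, ← intervalIntegral.integral_const_mul]
    refine integral_congr fun s hs => ?_
    rw [uIcc_of_le zero_le_one] at hs
    simp only [Real.mul_rpow hs.1 hv.le]
    ring
  rw [h2] at h
  simp only [zero_mul, one_mul, smul_eq_mul] at h
  rw [Real.rpow_add_one hv.ne', mul_right_comm, h]
  field_simp

/-- A bounded nonnegative perturbation `u^p ε(u)` with `ε → 0` at infinity does not change the
blow-up rate of `φ'' = φ^p`. -/
theorem exists_blowup_solution {p : ℝ} (hp : 1 < p) {ε : ℝ → ℝ} (hε : Continuous ε)
    (h0 : ∀ u, 0 ≤ ε u) {B : ℝ} (hB : ∀ u, ε u ≤ B) (hlim : Tendsto ε atTop (𝓝 0)) :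
    ∃ φ φ' : ℝ → ℝ, (∀ t < 0, 0 < φ t) ∧ (∀ t < 0, HasDerivAt φ (φ' t) t) ∧
      (∀ t < 0, HasDerivAt φ' (φ t ^ p * (1 + ε (φ t))) t) ∧
      Tendsto (fun t => (-t) ^ (2 / (p - 1)) * φ t) (𝓝[<] 0) (𝓝 (kappa0 p)) := by
  have hp0 : 0 < p := by linarith
  have hp1 : 0 < p - 1 := by linarith
  set α := 2 / (p - 1) with hα
  have hα0 : 0 < α := by positivity
  set M := scaledPrimitive p ε
  have hMc : Continuous M := continuous_scaledPrimitive hp0 hε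
  have hMb := scaledPrimitive_mem_Icc hp0 hε h0 hB
  have hMlim : Tendsto M atTop (𝓝 (1 / (p + 1))) :=
    tendsto_scaledPrimitive_atTop hp0 hε h0 hB hlim
  have hB0 : 0 ≤ B := (h0 0).trans (hB 0)
  set N : ℝ → ℝ := fun w => if w ≤ 0 then 1 / (p + 1) else M (w ^ (-α)) with hN
  have hNb : ∀ w, N w ∈ Icc (1 / (p + 1)) (1 / (p + 1) * (1 + B)) := by
    intro w
    by_cases hw : w ≤ 0
    · simp only [hN, hw, if_true]
      exact ⟨le_rfl, le_mul_of_one_le_right (by positivity) (by linarith)⟩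
    · simp only [hN, hw, if_false]
      exact hMb _
  have hNc : Continuous N := by
    rw [continuous_iff_continuousAt]
    intro x
    rcases lt_trichotomy x 0 with hx | rfl | hx
    · refine (continuousAt_const (y := 1 / (p + 1))).congr ?_
      filter_upwards [Iio_mem_nhds hx] with y hy
      simp [hN, (show y < 0 from hy).le]
    · rw [continuousAt_iff_continuous_left'_right']
      have hN0 : N 0 = 1 / (p + 1) := by simp [hN]
      constructor
      · refine ContinuousWithinAt.congr (f := fun _ => 1 / (p + 1)) continuousWithinAt_const
          (fun y hy => ?_) hN0
        simp [hN, (show y < 0 from hy).le]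
      · rw [ContinuousWithinAt, hN0]
        refine (hMlim.comp (tendsto_rpow_neg_nhdsGT_zero (neg_lt_zero.2 hα0))).congr' ?_
        filter_upwards [self_mem_nhdsWithin] with y hy
        simp [hN, not_le.2 (show 0 < y from hy)]
    · refine ContinuousAt.congr (f := fun w => M (w ^ (-α))) ?_ ?_
      · exact hMc.continuousAt.comp (Real.continuousAt_rpow_const _ _ (Or.inl hx.ne'))
      · filter_upwards [Ioi_mem_nhds hx] with y hy
        simp [hN, not_le.2 (show 0 < y from hy)]
  have hNpos : ∀ w, 0 < N w := fun w => lt_of_lt_of_le (by positivity) (hNb w).1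
  set K : ℝ → ℝ := fun w => α⁻¹ * √(2 * N w) with hK
  have hKpos : ∀ x, 0 < K x := fun x =>
    mul_pos (inv_pos.2 hα0) (Real.sqrt_pos.2 (by linarith [hNpos x]))
  obtain ⟨w, hw0, hw⟩ := exists_global_solution_of_continuous_pos_bounded (K := K)
    (C := α⁻¹ * √(2 * (1 / (p + 1) * (1 + B)))) (by fun_prop) hKpos
    (fun x => mul_le_mul_of_nonneg_left (Real.sqrt_le_sqrt (by linarith [(hNb x).2]))
      (inv_pos.2 hα0).le)
  have hwmono : StrictMono w := strictMono_of_hasDerivAt_pos hw fun x => hKpos _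
  have hwpos : ∀ t < 0, 0 < w (-t) := fun t ht => by
    rw [← hw0]; exact hwmono (neg_pos.2 ht)
  set φ : ℝ → ℝ := fun t => w (-t) ^ (-α) with hφ
  have hφpos : ∀ t < 0, 0 < φ t := fun t ht => Real.rpow_pos_of_pos (hwpos t ht) _
  set h : ℝ → ℝ := fun u => u ^ p * (1 + ε u)
  have hhc : Continuous h := by
    have : Continuous fun s : ℝ => s ^ p := continuous_id.rpow_const fun _ => Or.inr hp0.le
    fun_prop
  set G : ℝ → ℝ := fun v => ∫ u in (0 : ℝ)..v, h u
  have hGd : ∀ v, HasDerivAt G (h v) v := fun v => (hhc.integral_hasStrictDerivAt 0 v).hasDerivAt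
  have hGM : ∀ v, 0 < v → G v = v ^ (p + 1) * M v := fun v hv =>
    integral_eq_rpow_mul_scaledPrimitive p ε hv
  have hGpos : ∀ v, 0 < v → 0 < G v := fun v hv => by
    rw [hGM v hv]
    exact mul_pos (Real.rpow_pos_of_pos hv _) (lt_of_lt_of_le (by positivity) (hMb v).1)
  have hφd : ∀ t < 0, HasDerivAt φ (√(2 * G (φ t))) t := by
    intro t ht
    have hwt := hwpos t ht
    have h1 : HasDerivAt (fun t => w (-t)) (-K (w (-t))) t := by
      simpa [Function.comp_def] using (hw (-t)).scomp t (hasDerivAt_neg t)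
    have h2 := h1.rpow_const (p := -α) (Or.inl hwt.ne')
    convert h2 using 1
    have hsq : φ t ^ (p + 1) = (w (-t) ^ (-α - 1)) ^ 2 := by
      rw [hφ, ← Real.rpow_natCast, ← Real.rpow_mul hwt.le, ← Real.rpow_mul hwt.le]
      congr 1
      rw [hα]; push_cast; field_simp; ring
    have hNM : N (w (-t)) = M (φ t) := by simp [hN, hφ, not_le.2 hwt]
    rw [hGM _ (hφpos t ht), hsq, hK]
    simp only [hNM]
    rw [mul_left_comm, Real.sqrt_mul (sq_nonneg _), Real.sqrt_sq (Real.rpow_nonneg hwt.le _)]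
    field_simp
  refine ⟨φ, fun t => √(2 * G (φ t)), hφpos, hφd, fun t ht => ?_, ?_⟩
  · have hpos : 0 < 2 * G (φ t) := by linarith [hGpos _ (hφpos t ht)]
    have h1 := (((hGd (φ t)).comp t (hφd t ht)).const_mul 2).sqrt hpos.ne'
    refine h1.congr_deriv (Eq.symm ?_)
    have := Real.sqrt_pos.2 hpos
    change h (φ t) = 2 * (h (φ t) * √(2 * G (φ t))) / (2 * √(2 * G (φ t)))
    field_simp
  · have hslope : Tendsto (fun t => (-t)⁻¹ * w (-t)) (𝓝[<] 0) (𝓝 (K 0)) := by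
      have h1 := (hw 0).tendsto_slope_zero_right
      rw [hw0] at h1
      have h2 : Tendsto (fun t : ℝ => -t) (𝓝[<] 0) (𝓝[>] 0) := by
        simpa using tendsto_neg_nhdsLT (a := (0 : ℝ))
      simpa [Function.comp_def] using h1.comp h2
    have hk : kappa0 p = K 0 ^ (-α) := by
      have hN0 : N 0 = 1 / (p + 1) := by simp [hN]
      have hKsq : K 0 ^ 2 = (2 * (p + 1) / (p - 1) ^ 2)⁻¹ := by
        simp only [hK, hN0]
        rw [mul_pow, Real.sq_sqrt (by positivity), hα]
        field_simp
      have hb : 2 * (p + 1) / (p - 1) ^ 2 = K 0 ^ (-2 : ℝ) := by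
        rw [Real.rpow_neg (hKpos 0).le, Real.rpow_two, hKsq, inv_inv]
      rw [kappa0, hb, ← Real.rpow_mul (hKpos 0).le, hα]
      congr 1
      ring
    rw [hk]
    refine (hslope.rpow_const (p := -α) (Or.inl (hKpos 0).ne')).congr' ?_
    filter_upwards [self_mem_nhdsWithin] with t ht
    have ht' : 0 < -t := neg_pos.2 ht
    rw [Real.mul_rpow (inv_pos.2 ht').le (hwpos t ht).le, Real.inv_rpow ht'.le,
      Real.rpow_neg ht'.le, inv_inv]

theorem f_eq_rpow_mul {p : ℝ} (a : ℝ) {v : ℝ} (hv : 0 < v) :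
    f p a v = v ^ p * (Real.log (2 + v ^ 2) ^ a)⁻¹ := by
  rw [f, abs_of_pos hv, ← Real.rpow_add_one hv.ne', sub_add_cancel, div_eq_mul_inv]

/-- existence of a positive C² solution of `φ₀'' = φ₀^p + f(φ₀)` on `[-t₀,0)`
blowing up at `0` with the ODE blow-up rate `φ₀(t) ~ κ₀ (-t)^{-2/(p-1)}`. -/
theorem stmt_0 (p a : ℝ) (hp : 1 < p) (ha : 1 < a) :
    ∃ t₀ : ℝ, 0 < t₀ ∧ ∃ φ₀ φ₀' φ₀'' : ℝ → ℝ,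
      ContinuousOn φ₀'' (Set.Ico (-t₀) 0) ∧
      (∀ t ∈ Set.Ico (-t₀) (0:ℝ), HasDerivWithinAt φ₀ (φ₀' t) (Set.Ico (-t₀) 0) t) ∧
      (∀ t ∈ Set.Ico (-t₀) (0:ℝ), HasDerivWithinAt φ₀' (φ₀'' t) (Set.Ico (-t₀) 0) t) ∧
      (∀ t ∈ Set.Ico (-t₀) (0:ℝ), 0 < φ₀ t) ∧
      (∀ t ∈ Set.Ico (-t₀) (0:ℝ), φ₀'' t = φ₀ t ^ p + f p a (φ₀ t)) ∧
      Filter.Tendsto (fun t => (-t) ^ (2 / (p - 1)) * φ₀ t)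
        (nhdsWithin 0 (Set.Iio 0)) (nhds (kappa0 p)) := by
  have hlog : ∀ u : ℝ, Real.log 2 ≤ Real.log (2 + u ^ 2) := fun u =>
    Real.log_le_log two_pos (by nlinarith)
  have hlog2 : 0 < Real.log 2 := Real.log_pos one_lt_two
  have ha0 : 0 < a := by linarith
  obtain ⟨φ, φ', hpos, hd, hd', hlim⟩ := exists_blowup_solution hp
    (ε := fun u => (Real.log (2 + u ^ 2) ^ a)⁻¹) (B := (Real.log 2 ^ a)⁻¹)
    (by
      have h1 : Continuous fun u : ℝ => Real.log (2 + u ^ 2) :=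
        Continuous.log (by fun_prop) fun u => by positivity
      exact (h1.rpow_const fun _ => Or.inr ha0.le).inv₀ fun u =>
        (Real.rpow_pos_of_pos (hlog2.trans_le (hlog u)) a).ne')
    (fun u => inv_nonneg.2 (Real.rpow_nonneg (hlog2.trans_le (hlog u)).le a))
    (fun u => inv_anti₀ (Real.rpow_pos_of_pos hlog2 a)
      (Real.rpow_le_rpow hlog2.le (hlog u) ha0.le))
    (((tendsto_rpow_atTop ha0).comp (Real.tendsto_log_atTop.comp
      (tendsto_atTop_add_const_left _ 2 (tendsto_pow_atTop two_ne_zero)))).inv_tendsto_atTop)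
  refine ⟨1, one_pos, φ, φ', fun t => φ t ^ p * (1 + (Real.log (2 + φ t ^ 2) ^ a)⁻¹),
    ?_, fun t ht => (hd t ht.2).hasDerivWithinAt, fun t ht => (hd' t ht.2).hasDerivWithinAt,
    fun t ht => hpos t ht.2, fun t ht => ?_, hlim⟩
  · have hφc : ContinuousOn φ (Ico (-1) 0) := fun t ht =>
      (hd t ht.2).continuousAt.continuousWithinAt
    have h1 : ContinuousOn (fun t => Real.log (2 + φ t ^ 2)) (Ico (-1) 0) :=
      ContinuousOn.log (by fun_prop) fun t _ => by positivity
    exact (hφc.rpow_const fun t ht => Or.inl (hpos t ht.2).ne').mul (continuousOn_const.add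
      ((h1.rpow_const fun _ _ => Or.inr ha0.le).inv₀ fun t _ =>
        (Real.rpow_pos_of_pos (hlog2.trans_le (hlog _)) a).ne'))
  · simp only [f_eq_rpow_mul a (hpos t ht.2)]
    ring
end

section
/- Let p > 1 and a > 1, and let f(v) = |v|^{p-1} v / (log(2 + v^2))^a. There exists A₀ > 0 such that for every A ≥ A₀ and every B > 0 with B² ≥ A^{p+1}/(p+1), the maximal solution φ of the initial value problem φ''(t) = φ(t)^p + f(φ(t)), φ(0) = A, φ'(0) = B, defined on its maximal interval of existence [0, T_A), satisfies: φ'(t) ≥ 0 for all t ∈ [0, T_A), the maximal existence time T_A is finite, and φ(t) → +∞ as t → T_A⁻. -/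
open Filter Set

open MeasureTheory intervalIntegral Topology

lemma continuous_f {p : ℝ} (hp : 1 < p) (a : ℝ) : Continuous (f p a) := by
  have hlog : ∀ v : ℝ, 0 < Real.log (2 + v ^ 2) := fun v =>
    Real.log_pos (by nlinarith [sq_nonneg v])
  have h2 : ∀ v : ℝ, 2 + v ^ 2 ≠ 0 := fun v => by positivity
  unfold f
  refine Continuous.div ?_ ?_ fun v => (Real.rpow_pos_of_pos (hlog v) a).ne'
  · exact (continuous_abs.rpow_const fun _ => Or.inr (by linarith)).mul continuous_id
  · exact (Continuous.log (by fun_prop) h2).rpow_const fun v => Or.inl (hlog v).ne'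

lemma f_nonneg (p a : ℝ) {v : ℝ} (hv : 0 ≤ v) : 0 ≤ f p a v := by
  have hlog : 0 ≤ Real.log (2 + v ^ 2) := Real.log_nonneg (by nlinarith [sq_nonneg v])
  unfold f
  positivity

/-- Separation of variables for `φ' = v(φ)`: if the time `∫ 1 / v` needed to reach infinity is
finite, the solution starting at `A` blows up at that time. -/
lemma exists_blowup_of_integrableOn {v : ℝ → ℝ} {A B : ℝ} (hv : Continuous v)
    (hpos : ∀ x, 0 < v x) (hB : ∀ x ≤ A, v x = B)
    (hint : IntegrableOn (fun x => (v x)⁻¹) (Ioi A)) :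
    ∃ T : ℝ, 0 < T ∧ ∃ φ : ℝ → ℝ, φ 0 = A ∧ (∀ t ∈ Ico 0 T, A ≤ φ t) ∧
      (∀ t < T, HasDerivAt φ (v (φ t)) t) ∧ Tendsto φ (𝓝[<] T) atTop := by
  have hB0 : 0 < B := hB A le_rfl ▸ hpos A
  have hc : Continuous fun x => (v x)⁻¹ := hv.inv₀ fun x => (hpos x).ne'
  set τ : ℝ → ℝ := fun x => ∫ s in A..x, (v s)⁻¹ with hτ
  have hderiv : ∀ x, HasDerivAt τ (v x)⁻¹ x := fun x =>
    (hc.integral_hasStrictDerivAt A x).hasDerivAt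
  have hmono : StrictMono τ := strictMono_of_hasDerivAt_pos hderiv fun x => inv_pos.2 (hpos x)
  have hτA : τ A = 0 := integral_same
  set T := ∫ x in Ioi A, (v x)⁻¹
  have hlim : Tendsto τ atTop (𝓝 T) := intervalIntegral_tendsto_integral_Ioi A hint tendsto_id
  have hlt : ∀ x, τ x < T := fun x =>
    (hmono (lt_add_one x)).trans_le (hmono.monotone.ge_of_tendsto hlim _)
  have hτc : Continuous τ := continuous_iff_continuousAt.2 fun x => (hderiv x).continuousAt
  have hleft : ∀ t ≤ 0, τ (A + t * B) = t := by
    intro t ht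
    have : ∫ s in A..(A + t * B), (v s)⁻¹ = ∫ _ in A..(A + t * B), B⁻¹ := by
      refine integral_congr fun s hs => ?_
      rw [uIcc_of_ge (by nlinarith)] at hs
      simp only [hB s hs.2]
    simp only [hτ, this, intervalIntegral.integral_const, smul_eq_mul]
    field_simp
    ring
  have hsurj : ∀ t < T, ∃ x, τ x = t := by
    intro t ht
    refine mem_range_of_exists_le_of_exists_ge hτc ⟨A + min t 0 * B, ?_⟩ ?_
    · rw [hleft _ (min_le_right _ _)]
      exact min_le_left _ _
    · exact ((hlim.eventually (lt_mem_nhds ht)).exists).imp fun _ h => h.le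
  set φ : ℝ → ℝ := Function.invFun τ
  have hinv : ∀ t < T, τ (φ t) = t := fun t ht => Function.invFun_eq (hsurj t ht)
  have hinv' : ∀ x, φ (τ x) = x := Function.leftInverse_invFun hmono.injective
  have hφmono : StrictMonoOn φ (Iio T) := by
    intro s hs t ht hst
    rw [← hmono.lt_iff_lt, hinv s hs, hinv t ht]
    exact hst
  refine ⟨T, hτA ▸ hlt A, φ, by rw [← hτA, hinv'], ?_, ?_, ?_⟩
  · intro t ht
    rw [← hmono.le_iff_le, hinv t ht.2, hτA]
    exact ht.1
  · intro t ht
    have himg : φ '' Iio T = univ := eq_univ_of_forall fun x => ⟨τ x, hlt x, hinv' x⟩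
    have hφc : ContinuousAt φ t :=
      hφmono.continuousAt_of_image_mem_nhds (Iio_mem_nhds ht) (by simp [himg])
    have := (hderiv (φ t)).of_local_left_inverse hφc (inv_ne_zero (hpos _).ne')
      (eventually_of_mem (Iio_mem_nhds ht) hinv)
    simpa using this
  · refine tendsto_atTop.2 fun M => ?_
    filter_upwards [Ioo_mem_nhdsLT (hlt M)] with t ht
    rw [← hmono.le_iff_le, hinv t ht.2]
    exact ht.1.le

/-- for `A` large and `B > 0` with `B² ≥ A^{p+1}/(p+1)`, the (maximal) solution of
`φ'' = φ^p + f(φ)`, `φ(0) = A`, `φ'(0) = B` is nondecreasing and blows up in finite time: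
it is defined on a finite interval `[0,T)` with `φ' ≥ 0` and `φ(t) → +∞` as `t → T⁻`
(hence it cannot be extended beyond `T`, i.e. `T` is the finite maximal existence time). -/
theorem stmt_1 (p a : ℝ) (hp : 1 < p) (ha : 1 < a) :
    ∃ A₀ : ℝ, 0 < A₀ ∧ ∀ A : ℝ, A₀ ≤ A → ∀ B : ℝ, 0 < B →
      A ^ (p + 1) / (p + 1) ≤ B ^ 2 →
      ∃ T : ℝ, 0 < T ∧ ∃ φ φ' : ℝ → ℝ,
        φ 0 = A ∧ φ' 0 = B ∧
        (∀ t ∈ Set.Ico (0:ℝ) T, HasDerivWithinAt φ (φ' t) (Set.Ico 0 T) t) ∧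
        (∀ t ∈ Set.Ico (0:ℝ) T,
          HasDerivWithinAt φ' (φ t ^ p + f p a (φ t)) (Set.Ico 0 T) t) ∧
        (∀ t ∈ Set.Ico (0:ℝ) T, 0 ≤ φ' t) ∧
        Filter.Tendsto φ (nhdsWithin T (Set.Iio T)) Filter.atTop := by
  refine ⟨1, one_pos, fun A hA B hB hAB => ?_⟩
  have hA0 : 0 < A := by linarith
  have hrc : Continuous fun x : ℝ => x ^ p := Real.continuous_rpow_const (by linarith)
  set g : ℝ → ℝ := fun x => x ^ p + f p a x
  have hgc : Continuous g := hrc.add (continuous_f hp a)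
  -- `H` is the square of the velocity as a function of the position, by conservation of energy.
  set H : ℝ → ℝ := fun x => B ^ 2 + 2 * ∫ s in A..x, g s with hH
  have hHderiv : ∀ x, HasDerivAt H (2 * g x) x := fun x =>
    ((hgc.integral_hasStrictDerivAt A x).hasDerivAt.const_mul 2).const_add _
  have hHc : Continuous H := continuous_iff_continuousAt.2 fun x => (hHderiv x).continuousAt
  have hHA : H A = B ^ 2 := by simp [hH]
  have hHlow : ∀ x, A ≤ x → x ^ (p + 1) / (p + 1) ≤ H x := by
    intro x hx
    have h1 : ∫ s in A..x, s ^ p ≤ ∫ s in A..x, g s :=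
      integral_mono_on hx (hrc.intervalIntegrable _ _) (hgc.intervalIntegrable _ _)
        fun s hs => le_add_of_nonneg_right (f_nonneg p a (hA0.le.trans hs.1))
    rw [integral_rpow (Or.inl (by linarith)), sub_div] at h1
    have h2 : A ^ (p + 1) / (p + 1) ≤ x ^ (p + 1) / (p + 1) := by gcongr
    simp only [hH]
    linarith
  have hHpos : ∀ x, A ≤ x → 0 < H x := fun x hx =>
    lt_of_lt_of_le (by have := hA0.trans_le hx; positivity) (hHlow x hx)
  set v : ℝ → ℝ := fun x => √(H (max x A)) with hv
  have hvc : Continuous v := (hHc.comp (continuous_id.max continuous_const)).sqrt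
  have hvpos : ∀ x, 0 < v x := fun x => Real.sqrt_pos.2 (hHpos _ (le_max_right _ _))
  have hvB : ∀ x ≤ A, v x = B := fun x hx => by
    simp only [hv, max_eq_right hx, hHA, Real.sqrt_sq hB.le]
  have hint : IntegrableOn (fun x => (v x)⁻¹) (Ioi A) := by
    have hI := (integrableOn_Ioi_rpow_of_lt (a := -((p + 1) / 2)) (by linarith) hA0).const_mul
      (√(p + 1))
    refine hI.mono' (hvc.inv₀ fun x => (hvpos x).ne').aestronglyMeasurable ?_
    refine (ae_restrict_iff' measurableSet_Ioi).2 (ae_of_all _ fun x hx => ?_)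
    have hxA : A ≤ x := le_of_lt (mem_Ioi.1 hx)
    have hx0 : 0 < x := hA0.trans_le hxA
    rw [Real.norm_of_nonneg (inv_nonneg.2 (hvpos x).le)]
    have h1 : √(x ^ (p + 1) / (p + 1)) ≤ v x := by
      simp only [hv, max_eq_left hxA]
      exact Real.sqrt_le_sqrt (hHlow x hxA)
    have h2 : √(x ^ (p + 1) / (p + 1)) = x ^ ((p + 1) / 2) / √(p + 1) := by
      rw [Real.sqrt_div (by positivity), Real.sqrt_eq_rpow, ← Real.rpow_mul hx0.le]
      ring_nf
    rw [h2] at h1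
    calc (v x)⁻¹ ≤ (x ^ ((p + 1) / 2) / √(p + 1))⁻¹ := by
          gcongr
      _ = √(p + 1) * x ^ (-((p + 1) / 2)) := by
          rw [inv_div, Real.rpow_neg hx0.le, div_eq_mul_inv]
  obtain ⟨T, hT, φ, hφ0, hφA, hφ, hφT⟩ := exists_blowup_of_integrableOn hvc hvpos hvB hint
  refine ⟨T, hT, φ, fun t => v (φ t), hφ0, ?_, fun t ht => (hφ t ht.2).hasDerivWithinAt, ?_,
    fun t _ => (hvpos _).le, hφT⟩
  · simp only [hφ0, hvB A le_rfl]
  · intro t ht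
    have heq : ∀ s ∈ Ico 0 T, v (φ s) = √(H (φ s)) := fun s hs => by
      simp only [hv, max_eq_left (hφA s hs)]
    have h0 := hvpos (φ t)
    have h1 := ((hHderiv (φ t)).sqrt (hHpos _ (hφA t ht)).ne').comp t (hφ t ht.2)
    rw [← heq t ht] at h1
    refine (h1.hasDerivWithinAt.congr heq (heq t ht)).congr_deriv ?_
    field_simp
    rfl
end

section
/- Let p > 1 and a > 1, and let f(v) = |v|^{p-1} v / (log(2 + v^2))^a. Let T > t₁ be real numbers and let φ : [t₁, T) → ℝ be a C² function such that φ''(t) = |φ(t)|^{p-1} φ(t) + f(φ(t)) on [t₁, T), φ'(t) ≥ 0 on [t₁, T), and φ(t) → +∞ as t → T⁻. Then (T - t)^{2/(p-1)} · φ(t) → κ₀ as t → T⁻. -/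
open Filter Set

open Topology

/-- If `F' ≤ c G'` near `T⁻` and `G → +∞`, then eventually `F / G < d` for every `d > c`. -/
theorem eventually_div_lt_of_deriv_le {F F' G G' : ℝ → ℝ} {T c d : ℝ} (hcd : c < d)
    (hF : ∀ᶠ t in 𝓝[<] T, HasDerivAt F (F' t) t)
    (hG : ∀ᶠ t in 𝓝[<] T, HasDerivAt G (G' t) t)
    (hle : ∀ᶠ t in 𝓝[<] T, F' t ≤ c * G' t)
    (hGtop : Tendsto G (𝓝[<] T) atTop) :
    ∀ᶠ t in 𝓝[<] T, F t / G t < d := by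
  obtain ⟨l, hl, h⟩ := mem_nhdsLT_iff_exists_Ioo_subset.1 (hF.and (hG.and hle))
  obtain ⟨s, hls, hsT⟩ := exists_between (mem_Iio.1 hl)
  have hmem : ∀ t ∈ Ico s T, t ∈ Ioo l T := fun t ht => ⟨hls.trans_le ht.1, ht.2⟩
  have hderiv : ∀ t ∈ Ico s T, HasDerivAt (fun t => F t - c * G t) (F' t - c * G' t) t :=
    fun t ht => (h (hmem t ht)).1.sub ((h (hmem t ht)).2.1.const_mul c)
  have hanti : AntitoneOn (fun t => F t - c * G t) (Ico s T) := by
    refine antitoneOn_of_hasDerivWithinAt_nonpos (convex_Ico s T)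
      (fun t ht => (hderiv t ht).continuousAt.continuousWithinAt)
      (fun t ht => (hderiv t (interior_subset ht)).hasDerivWithinAt) fun t ht => ?_
    exact sub_nonpos.2 (h (hmem t (interior_subset ht))).2.2
  filter_upwards [hGtop.eventually_gt_atTop 0,
    hGtop.eventually_gt_atTop ((F s - c * G s) / (d - c)), Ico_mem_nhdsLT hsT] with t h0 h1 ht
  have h2 : F t - c * G t ≤ F s - c * G s := hanti (left_mem_Ico.2 hsT) ht ht.1
  rw [div_lt_iff₀ (sub_pos.2 hcd)] at h1
  rw [div_lt_iff₀ h0]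
  linarith

/-- L'Hôpital's rule at a left endpoint for a denominator tending to `+∞`. -/
theorem tendsto_div_of_deriv_div_of_atTop {F F' G G' : ℝ → ℝ} {T L : ℝ}
    (hF : ∀ᶠ t in 𝓝[<] T, HasDerivAt F (F' t) t)
    (hG : ∀ᶠ t in 𝓝[<] T, HasDerivAt G (G' t) t)
    (hG' : ∀ᶠ t in 𝓝[<] T, 0 < G' t)
    (hGtop : Tendsto G (𝓝[<] T) atTop)
    (hL : Tendsto (fun t => F' t / G' t) (𝓝[<] T) (𝓝 L)) :
    Tendsto (fun t => F t / G t) (𝓝[<] T) (𝓝 L) := by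
  refine tendsto_order.2 ⟨fun d hd => ?_, fun d hd => ?_⟩
  · obtain ⟨c, hdc, hcL⟩ := exists_between hd
    have key := eventually_div_lt_of_deriv_le (neg_lt_neg hdc) (hF.mono fun t ht => ht.neg) hG
      (by
        filter_upwards [hG', hL.eventually_const_lt hcL] with t h0 h1
        rw [lt_div_iff₀ h0] at h1
        linarith) hGtop
    filter_upwards [key] with t ht
    simp only [Pi.neg_apply, neg_div] at ht
    linarith
  · obtain ⟨c, hLc, hcd⟩ := exists_between hd
    refine eventually_div_lt_of_deriv_le hcd hF hG ?_ hGtop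
    filter_upwards [hG', hL.eventually_lt_const hLc] with t h0 h1
    exact ((div_lt_iff₀ h0).1 h1).le

/-- The full nonlinearity is asymptotic to the pure power at `+∞`. -/
theorem tendsto_pure_power_add_f_div_rpow {p a : ℝ} (ha : 0 < a) :
    Tendsto (fun v : ℝ => (|v| ^ (p - 1) * v + f p a v) / v ^ p) atTop (𝓝 1) := by
  have hlog : Tendsto (fun v : ℝ => Real.log (2 + v ^ 2) ^ a) atTop atTop :=
    (tendsto_rpow_atTop ha).comp (Real.tendsto_log_atTop.comp
      (tendsto_atTop_add_const_left _ _ (tendsto_pow_atTop two_ne_zero)))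
  have h1 : Tendsto (fun v : ℝ => 1 + (Real.log (2 + v ^ 2) ^ a)⁻¹) atTop (𝓝 1) := by
    simpa using (tendsto_inv_atTop_zero.comp hlog).const_add 1
  refine h1.congr' ?_
  filter_upwards [eventually_gt_atTop 0] with v hv
  have hpow : |v| ^ (p - 1) * v = v ^ p := by
    rw [abs_of_pos hv, ← Real.rpow_add_one hv.ne', sub_add_cancel]
  have hne : v ^ p ≠ 0 := (Real.rpow_pos_of_pos hv p).ne'
  rw [f, hpow]
  field_simp

theorem f_pos {p a v : ℝ} (hv : 0 < v) : 0 < f p a v := by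
  have : 0 < Real.log (2 + v ^ 2) := Real.log_pos (by nlinarith)
  unfold f
  positivity

/-- a nondecreasing C² solution of `φ'' = |φ|^{p-1}φ + f(φ)` on `[t₁,T)` that
blows up at `T` satisfies `(T-t)^{2/(p-1)} φ(t) → κ₀` as `t → T⁻`. -/
theorem stmt_2 (p a t₁ T : ℝ) (hp : 1 < p) (ha : 1 < a) (hT : t₁ < T)
    (φ φ' φ'' : ℝ → ℝ)
    (hC : ContinuousOn φ'' (Set.Ico t₁ T))
    (hd1 : ∀ t ∈ Set.Ico t₁ T, HasDerivWithinAt φ (φ' t) (Set.Ico t₁ T) t)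
    (hd2 : ∀ t ∈ Set.Ico t₁ T, HasDerivWithinAt φ' (φ'' t) (Set.Ico t₁ T) t)
    (hode : ∀ t ∈ Set.Ico t₁ T, φ'' t = |φ t| ^ (p - 1) * φ t + f p a (φ t))
    (hmono : ∀ t ∈ Set.Ico t₁ T, 0 ≤ φ' t)
    (hblow : Filter.Tendsto φ (nhdsWithin T (Set.Iio T)) Filter.atTop) :
    Filter.Tendsto (fun t => (T - t) ^ (2 / (p - 1)) * φ t)
      (nhdsWithin T (Set.Iio T)) (nhds (kappa0 p)) := by
  have hIoo : ∀ᶠ t in 𝓝[<] T, t ∈ Ioo t₁ T := Ioo_mem_nhdsLT hT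
  have hD1 : ∀ᶠ t in 𝓝[<] T, HasDerivAt φ (φ' t) t := hIoo.mono fun t ht =>
    (hd1 t (Ioo_subset_Ico_self ht)).hasDerivAt (Ico_mem_nhds ht.1 ht.2)
  have hD2 : ∀ᶠ t in 𝓝[<] T, HasDerivAt φ' (φ'' t) t := hIoo.mono fun t ht =>
    (hd2 t (Ioo_subset_Ico_self ht)).hasDerivAt (Ico_mem_nhds ht.1 ht.2)
  have hpos : ∀ᶠ t in 𝓝[<] T, 0 < φ t := hblow.eventually_gt_atTop 0
  have hpos' : ∀ᶠ t in 𝓝[<] T, 0 < φ' t := by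
    obtain ⟨l, hl, h⟩ := mem_nhdsLT_iff_exists_Ioo_subset.1 (hIoo.and (hD2.and hpos))
    have hstrict : StrictMonoOn φ' (Ioo l T) := by
      refine strictMonoOn_of_hasDerivWithinAt_pos (convex_Ioo l T)
        (fun t ht => (h ht).2.1.continuousAt.continuousWithinAt)
        (fun t ht => (h (interior_subset ht)).2.1.hasDerivWithinAt) fun t ht => ?_
      obtain ⟨ht1, -, ht2⟩ := h (interior_subset ht)
      rw [hode t (Ioo_subset_Ico_self ht1)]
      have := f_pos (p := p) (a := a) ht2
      positivity
    filter_upwards [Ioo_mem_nhdsLT hl] with t ht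
    obtain ⟨s, hls, hst⟩ := exists_between ht.1
    have hs : s ∈ Ioo l T := ⟨hls, hst.trans ht.2⟩
    exact (hmono s (Ioo_subset_Ico_self (h hs).1)).trans_lt (hstrict hs ht hst)
  have hp1 : 0 < p - 1 := sub_pos.2 hp
  have hp2 : 0 < p + 1 := by linarith
  have henergy : Tendsto (fun t => φ' t ^ 2 / φ t ^ (p + 1)) (𝓝[<] T) (𝓝 (2 / (p + 1))) := by
    refine tendsto_div_of_deriv_div_of_atTop
      (F' := fun t => 2 * φ' t * φ'' t) (G' := fun t => φ' t * (p + 1) * φ t ^ p) ?_ ?_ ?_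
      ((tendsto_rpow_atTop hp2).comp hblow) ?_
    · filter_upwards [hD2] with t ht
      simpa using ht.fun_pow 2
    · filter_upwards [hD1, hpos] with t ht h0
      simpa using ht.rpow_const (p := p + 1) (Or.inl h0.ne')
    · filter_upwards [hpos, hpos'] with t h0 h1
      positivity
    · have h1 := ((tendsto_pure_power_add_f_div_rpow (p := p) (zero_lt_one.trans ha)).comp
        hblow).const_mul (2 / (p + 1))
      rw [mul_one] at h1
      refine h1.congr' ?_
      filter_upwards [hIoo, hpos, hpos'] with t ht h0 h1
      have hne : φ t ^ p ≠ 0 := (Real.rpow_pos_of_pos h0 p).ne'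
      rw [Function.comp_apply, ← hode t (Ioo_subset_Ico_self ht)]
      field_simp
  set c : ℝ := (p - 1) / 2 * √(2 / (p + 1)) with hc
  have hcpos : 0 < c := by positivity
  have hw' : Tendsto (fun t => φ' t * (-((p - 1) / 2)) * φ t ^ (-((p - 1) / 2) - 1) / (-1))
      (𝓝[<] T) (𝓝 c) := by
    refine (henergy.sqrt.const_mul ((p - 1) / 2)).congr' ?_
    filter_upwards [hpos, hpos'] with t h0 h1
    have hexp : -((p - 1) / 2) - 1 = -((p + 1) * (1 / 2)) := by ring
    rw [Real.sqrt_div (sq_nonneg _), Real.sqrt_sq h1.le, hexp, Real.rpow_neg h0.le,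
      Real.rpow_mul h0.le, ← Real.sqrt_eq_rpow]
    ring
  have hw : Tendsto (fun t => φ t ^ (-((p - 1) / 2)) / (T - t)) (𝓝[<] T) (𝓝 c) := by
    refine HasDerivAt.lhopital_zero_nhdsLT (g' := fun _ => -1) ?_ ?_ ?_ ?_ ?_ hw'
    · filter_upwards [hD1, hpos] with t ht h0
      exact ht.rpow_const (Or.inl h0.ne')
    · exact Eventually.of_forall fun t => by simpa using (hasDerivAt_id t).const_sub T
    · exact Eventually.of_forall fun t => by norm_num
    · exact (tendsto_rpow_neg_atTop (half_pos hp1)).comp hblow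
    · have : Tendsto (fun t => T - t) (𝓝 T) (𝓝 (T - T)) := tendsto_const_nhds.sub tendsto_id
      rw [sub_self] at this
      exact this.mono_left nhdsWithin_le_nhds
  have hkappa : c ^ (-(2 / (p - 1))) = kappa0 p := by
    have hsq : (c ^ 2)⁻¹ = 2 * (p + 1) / (p - 1) ^ 2 := by
      rw [hc, mul_pow, Real.sq_sqrt (by positivity)]
      field_simp
    rw [kappa0, ← hsq, Real.inv_rpow (by positivity), ← Real.rpow_natCast, ← Real.rpow_mul hcpos.le,
      Real.rpow_neg hcpos.le]
    congr 2
    push_cast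
    ring
  rw [← hkappa]
  refine (hw.rpow_const (Or.inl hcpos.ne')).congr' ?_
  filter_upwards [hIoo, hpos] with t ht h0
  have hTt : 0 < T - t := sub_pos.2 ht.2
  have hexp : -((p - 1) / 2) * -(2 / (p - 1)) = 1 := by field_simp
  rw [Real.div_rpow (by positivity) hTt.le, ← Real.rpow_mul h0.le, hexp, Real.rpow_one,
    Real.rpow_neg hTt.le, div_inv_eq_mul, mul_comm]
end

section
/- Let p > 1 and a > 1, let f(v) = |v|^{p-1} v / (log(2 + v^2))^a, and let t₀ > 0. Suppose φ₀ : [-t₀, 0) → (0, ∞) is a C² function such that φ₀''(t) = φ₀(t)^p + f(φ₀(t)) on [-t₀, 0), φ₀'(t) ≥ 0 on [-t₀, 0), and (-t)^{2/(p-1)} · φ₀(t) → κ₀ as t → 0⁻. Define φ(s) = e^{-2s/(p-1)} · φ₀(-e^{-s}). Then s^a · (φ(s) - κ₀) → -κ₀ (p-1)^{a-1} / 4^a as s → +∞; equivalently, φ(s) - κ₀ is asymptotically equivalent to -(κ₀/(p-1)) · ((p-1)/(4s))^a as s → +∞. -/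
open Filter Set

open scoped Topology

/-- One-sided comparison underlying the `∞/∞` form of l'Hôpital's rule. -/
lemma eventually_le_mul_of_deriv_le {x₀ : ℝ} {N D N' D' : ℝ → ℝ}
    (hN : ∀ᶠ t in 𝓝[<] x₀, HasDerivAt N (N' t) t)
    (hD : ∀ᶠ t in 𝓝[<] x₀, HasDerivAt D (D' t) t)
    (hDtop : Tendsto D (𝓝[<] x₀) atTop) {c c' : ℝ} (hcc : c < c')
    (h : ∀ᶠ t in 𝓝[<] x₀, N' t ≤ c * D' t) :
    ∀ᶠ t in 𝓝[<] x₀, N t ≤ c' * D t := by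
  obtain ⟨t₁, ht₁, hall⟩ :=
    (mem_nhdsLT_iff_exists_Ioo_subset (a := x₀)).1 (hN.and (hD.and h))
  have ht₁ : t₁ < x₀ := ht₁
  obtain ⟨t₂, h₁₂, h₂⟩ := exists_between ht₁
  have hderiv : ∀ t ∈ Ioo t₁ x₀, HasDerivAt (fun t => N t - c * D t) (N' t - c * D' t) t :=
    fun t ht => (hall ht).1.sub ((hall ht).2.1.const_mul c)
  have hanti : AntitoneOn (fun t => N t - c * D t) (Ioo t₁ x₀) := by
    refine antitoneOn_of_deriv_nonpos (convex_Ioo _ _)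
      (fun t ht => (hderiv t ht).continuousAt.continuousWithinAt)
      (fun t ht => ?_) (fun t ht => ?_)
    · rw [interior_Ioo] at ht
      exact (hderiv t ht).differentiableAt.differentiableWithinAt
    · rw [interior_Ioo] at ht
      rw [(hderiv t ht).deriv]
      linarith [(hall ht).2.2]
  filter_upwards [Ioo_mem_nhdsLT h₂,
    hDtop.eventually_ge_atTop ((N t₂ - c * D t₂) / (c' - c))] with t ht hbig
  have h1 := hanti ⟨h₁₂, h₂⟩ ⟨h₁₂.trans ht.1, ht.2⟩ ht.1.le
  rw [div_le_iff₀ (by linarith)] at hbig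
  simp only at h1
  linarith

/-- L'Hôpital's rule for a denominator tending to infinity, without nonvanishing of its
derivative. -/
lemma tendsto_div_of_deriv_sub_le {x₀ l : ℝ} {N D N' D' : ℝ → ℝ}
    (hN : ∀ᶠ t in 𝓝[<] x₀, HasDerivAt N (N' t) t)
    (hD : ∀ᶠ t in 𝓝[<] x₀, HasDerivAt D (D' t) t)
    (hDtop : Tendsto D (𝓝[<] x₀) atTop)
    (h : ∀ ε > 0, ∀ᶠ t in 𝓝[<] x₀, |N' t - l * D' t| ≤ ε * D' t) :
    Tendsto (fun t => N t / D t) (𝓝[<] x₀) (𝓝 l) := by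
  rw [Metric.tendsto_nhds]
  intro ε hε
  have hup := eventually_le_mul_of_deriv_le hN hD hDtop
    (c := l + ε / 4) (c' := l + ε / 2) (by linarith) (by
      filter_upwards [h (ε / 4) (by positivity)] with t ht
      linarith [(abs_le.1 ht).2])
  have hlow := eventually_le_mul_of_deriv_le (hN.mono fun t ht => ht.neg) hD hDtop
    (c := -l + ε / 4) (c' := -l + ε / 2) (by linarith) (by
      filter_upwards [h (ε / 4) (by positivity)] with t ht
      linarith [(abs_le.1 ht).1])
  filter_upwards [hup, hlow, hDtop.eventually_gt_atTop 0] with t h1 h2 h3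
  simp only [Pi.neg_apply] at h2
  rw [Real.dist_eq, abs_lt]
  have e : N t / D t - l = (N t - l * D t) / D t := by field_simp
  rw [e, lt_div_iff₀ h3, div_lt_iff₀ h3]
  constructor <;> nlinarith

/-- The delta method: first-order expansion of `h ∘ y` at a limit point of `y`. -/
lemma HasDerivAt.tendsto_mul_comp_sub {α : Type*} {F : Filter α} {h : ℝ → ℝ} {h' b L : ℝ}
    {y r : α → ℝ} (hh : HasDerivAt h h' b) (hy : Tendsto y F (𝓝 b))
    (hr : Tendsto (fun x => r x * (y x - b)) F (𝓝 L)) :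
    Tendsto (fun x => r x * (h (y x) - h b)) F (𝓝 (h' * L)) := by
  have hc : ContinuousAt (dslope h b) b := continuousAt_dslope_same.2 hh.differentiableAt
  have h1 := hc.tendsto.comp hy
  rw [dslope_same, hh.deriv] at h1
  refine (h1.mul hr).congr fun x => ?_
  have := sub_smul_dslope h b (y x)
  rw [smul_eq_mul] at this
  simp only [Function.comp]
  rw [← this]
  ring

lemma tendsto_rpow_div_log_rpow_atTop {p a : ℝ} (hp : 0 < p + 1) :
    Tendsto (fun v : ℝ => v ^ (p + 1) / Real.log (2 + v ^ 2) ^ a) atTop atTop := by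
  have h0 : Tendsto (fun v : ℝ => 2 + v ^ 2) atTop atTop :=
    tendsto_atTop_add_const_left _ _ (tendsto_pow_atTop two_ne_zero)
  have h1 := ((isLittleO_log_rpow_rpow_atTop a
    (show 0 < (p + 1) / 3 by positivity)).tendsto_div_nhds_zero).comp h0
  have h2 : Tendsto (fun v : ℝ => Real.log (2 + v ^ 2) ^ a / (2 + v ^ 2) ^ ((p + 1) / 3))
      atTop (𝓝[>] 0) := by
    refine tendsto_nhdsWithin_iff.2 ⟨h1, Eventually.of_forall fun v => ?_⟩
    have : 0 < Real.log (2 + v ^ 2) := Real.log_pos (by nlinarith [sq_nonneg v])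
    simp only [mem_Ioi]
    positivity
  refine tendsto_atTop_mono' _ ?_ h2.inv_tendsto_nhdsGT_zero
  filter_upwards [eventually_ge_atTop 2] with v hv
  have hL : 0 < Real.log (2 + v ^ 2) := Real.log_pos (by nlinarith [sq_nonneg v])
  rw [Pi.inv_apply, inv_div]
  have h3 : (2 + v ^ 2) ^ ((p + 1) / 3) ≤ v ^ (p + 1) := by
    calc (2 + v ^ 2) ^ ((p + 1) / 3) ≤ (v ^ (3 : ℝ)) ^ ((p + 1) / 3) := by
          refine Real.rpow_le_rpow (by positivity) ?_ (by positivity)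
          norm_cast
          nlinarith [sq_nonneg v]
      _ = v ^ (p + 1) := by
          rw [← Real.rpow_mul (by linarith)]
          congr 1
          ring
  gcongr

lemma tendsto_of_tendsto_mul_sub {α : Type*} {F : Filter α} {r y : α → ℝ} {b L : ℝ}
    (hr : Tendsto r F atTop) (h : Tendsto (fun x => r x * (y x - b)) F (𝓝 L)) :
    Tendsto y F (𝓝 b) := by
  have h1 := (h.div_atTop hr).add_const b
  rw [zero_add] at h1
  refine h1.congr' ?_
  filter_upwards [hr.eventually_gt_atTop 0] with x hx
  field_simp
  ring

lemma log_two_add_sq_pos (v : ℝ) : 0 < Real.log (2 + v ^ 2) :=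
  Real.log_pos (by nlinarith [sq_nonneg v])

lemma f_of_pos {p a v : ℝ} (hv : 0 < v) : f p a v = v ^ p / Real.log (2 + v ^ 2) ^ a := by
  rw [f, abs_of_pos hv]
  congr 1
  nth_rewrite 2 [← Real.rpow_one v]
  rw [← Real.rpow_add hv]
  congr 1
  ring

lemma tendsto_neg_nhdsLT_zero : Tendsto (fun t : ℝ => -t) (𝓝[<] 0) (𝓝[>] 0) := by
  simpa using tendsto_neg_nhdsLT (a := (0 : ℝ))

lemma tendsto_neg_log_neg_nhdsLT_zero :
    Tendsto (fun t : ℝ => -Real.log (-t)) (𝓝[<] 0) atTop :=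
  tendsto_neg_atBot_atTop.comp (Real.tendsto_log_nhdsGT_zero.comp tendsto_neg_nhdsLT_zero)

lemma tendsto_neg_rpow_nhdsLT_zero {q : ℝ} (hq : 0 < q) :
    Tendsto (fun t : ℝ => (-t) ^ q) (𝓝[<] 0) (𝓝[>] 0) := by
  refine tendsto_nhdsWithin_iff.2 ⟨?_, ?_⟩
  · have h := (Real.continuousAt_rpow_const 0 q (Or.inr hq.le)).tendsto.comp
      (tendsto_neg_nhdsLT_zero.mono_right nhdsWithin_le_nhds)
    rw [Real.zero_rpow hq.ne'] at h
    exact h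
  · filter_upwards [self_mem_nhdsWithin] with t ht
    have ht : 0 < -t := neg_pos.2 ht
    exact Real.rpow_pos_of_pos ht q

lemma tendsto_atTop_of_neg_rpow_mul {q κ : ℝ} {V : ℝ → ℝ} (hq : 0 < q) (hκ : 0 < κ)
    (hV : Tendsto (fun t => (-t) ^ q * V t) (𝓝[<] 0) (𝓝 κ)) :
    Tendsto V (𝓝[<] 0) atTop := by
  refine (hV.pos_mul_atTop hκ (tendsto_neg_rpow_nhdsLT_zero hq).inv_tendsto_nhdsGT_zero).congr' ?_
  filter_upwards [self_mem_nhdsWithin] with t ht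
  have ht : 0 < -t := neg_pos.2 ht
  have := Real.rpow_pos_of_pos ht q
  simp only [Pi.inv_apply]
  field_simp

lemma tendsto_log_two_add_sq_div {q κ : ℝ} {V : ℝ → ℝ} (hq : 0 < q) (hκ : 0 < κ)
    (hV : Tendsto (fun t => (-t) ^ q * V t) (𝓝[<] 0) (𝓝 κ)) :
    Tendsto (fun t => Real.log (2 + V t ^ 2) / (-Real.log (-t))) (𝓝[<] 0) (𝓝 (2 * q)) := by
  have hτ := (tendsto_neg_rpow_nhdsLT_zero hq).mono_right nhdsWithin_le_nhds
  have h1 := ((hτ.pow 2).const_mul 2).add (hV.pow 2)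
  have h2 := (Real.continuousAt_log (x := 2 * 0 ^ 2 + κ ^ 2) (by positivity)).tendsto.comp h1
  have h3 := (h2.div_atTop tendsto_neg_log_neg_nhdsLT_zero).add_const (2 * q)
  rw [zero_add] at h3
  refine h3.congr' ?_
  filter_upwards [self_mem_nhdsWithin,
    tendsto_neg_log_neg_nhdsLT_zero.eventually_gt_atTop 0] with t ht hlog
  have ht : 0 < -t := neg_pos.2 ht
  have hp := Real.rpow_pos_of_pos ht q
  have e : 2 * ((-t) ^ q) ^ 2 + ((-t) ^ q * V t) ^ 2 = ((-t) ^ q) ^ 2 * (2 + V t ^ 2) := by ring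
  simp only [Function.comp]
  rw [e, Real.log_mul (by positivity) (by positivity), Real.log_pow, Real.log_rpow ht]
  have : Real.log (-t) ≠ 0 := by linarith
  push_cast
  field_simp
  ring

/-- Asymptotics of the energy identity for `V'' = V ^ p + f(V)`. -/
lemma tendsto_log_rpow_mul_energy {p a : ℝ} {V V' : ℝ → ℝ} (hp : 0 < p + 1) (ha : 0 < a)
    (hV : ∀ᶠ t in 𝓝[<] 0, HasDerivAt V (V' t) t)
    (hV' : ∀ᶠ t in 𝓝[<] 0, HasDerivAt V' (V t ^ p + f p a (V t)) t)
    (hmono : ∀ᶠ t in 𝓝[<] 0, 0 ≤ V' t) (htop : Tendsto V (𝓝[<] 0) atTop) :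
    Tendsto (fun t => Real.log (2 + V t ^ 2) ^ a * (V' t ^ 2 / V t ^ (p + 1) - 2 / (p + 1)))
      (𝓝[<] 0) (𝓝 (2 / (p + 1))) := by
  have hpos := htop.eventually_gt_atTop 0
  have hLtop : Tendsto (fun t => Real.log (2 + V t ^ 2)) (𝓝[<] 0) atTop :=
    Real.tendsto_log_atTop.comp (tendsto_atTop_add_const_left _ _
      ((tendsto_pow_atTop two_ne_zero).comp htop))
  have key := tendsto_div_of_deriv_sub_le (x₀ := 0) (l := 2 / (p + 1))
    (N := fun t => V' t ^ 2 - 2 / (p + 1) * V t ^ (p + 1))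
    (D := fun t => V t ^ (p + 1) / Real.log (2 + V t ^ 2) ^ a)
    (N' := fun t => 2 * (V' t * (V t ^ p / Real.log (2 + V t ^ 2) ^ a)))
    (D' := fun t => V' t * (V t ^ p / Real.log (2 + V t ^ 2) ^ a) *
      ((p + 1) - a / Real.log (2 + V t ^ 2) * (2 * V t ^ 2 / (2 + V t ^ 2))))
    ?_ ?_ ((tendsto_rpow_div_log_rpow_atTop hp).comp htop) ?_
  · refine key.congr' ?_
    filter_upwards [hpos] with t ht
    have h1 := Real.rpow_pos_of_pos ht (p + 1)
    have h2 := Real.rpow_pos_of_pos (log_two_add_sq_pos (V t)) a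
    field_simp
  · filter_upwards [hV, hV', hpos] with t h1 h2 h3
    rw [f_of_pos h3] at h2
    have := (h2.pow 2).sub ((h1.rpow_const (p := p + 1) (Or.inl h3.ne')).const_mul (2 / (p + 1)))
    refine this.congr_deriv ?_
    rw [add_sub_cancel_right]
    field_simp
    push_cast
    ring
  · filter_upwards [hV, hpos] with t h1 h3
    have hL := log_two_add_sq_pos (V t)
    have hLa := Real.rpow_pos_of_pos hL a
    have h4 : HasDerivAt (fun t => Real.log (2 + V t ^ 2)) (2 * V t * V' t / (2 + V t ^ 2)) t := by
      have := (((h1.pow 2).const_add 2).log (by simp only [Pi.pow_apply]; positivity))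
      refine this.congr_deriv ?_
      simp
    have := (h1.rpow_const (p := p + 1) (Or.inl h3.ne')).div
      (h4.rpow_const (p := a) (Or.inl hL.ne')) hLa.ne'
    refine this.congr_deriv ?_
    rw [add_sub_cancel_right, Real.rpow_sub hL, Real.rpow_one, Real.rpow_add h3, Real.rpow_one]
    field_simp
  · intro ε hε
    have hl : 0 < 2 / (p + 1) := by positivity
    filter_upwards [hmono, hpos,
      hLtop.eventually_ge_atTop (2 * a * (2 / (p + 1) + ε) / (ε * (p + 1)))] with t h1 h3 h5
    have hL := log_two_add_sq_pos (V t)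
    have hg : 0 ≤ V' t * (V t ^ p / Real.log (2 + V t ^ 2) ^ a) := by positivity
    have hδ0 : 0 ≤ a / Real.log (2 + V t ^ 2) * (2 * V t ^ 2 / (2 + V t ^ 2)) := by positivity
    have hδ : a / Real.log (2 + V t ^ 2) * (2 * V t ^ 2 / (2 + V t ^ 2)) ≤
        a / Real.log (2 + V t ^ 2) * 2 := by
      gcongr
      rw [div_le_iff₀ (by positivity)]
      linarith
    have hδ' : (2 / (p + 1) + ε) * (a / Real.log (2 + V t ^ 2) * 2) ≤ ε * (p + 1) := by
      rw [div_le_iff₀ (by positivity)] at h5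
      calc _ = 2 * a * (2 / (p + 1) + ε) / Real.log (2 + V t ^ 2) := by ring
        _ ≤ _ := by
          rw [div_le_iff₀ hL]
          linarith
    generalize a / Real.log (2 + V t ^ 2) * (2 * V t ^ 2 / (2 + V t ^ 2)) = δ at *
    generalize V' t * (V t ^ p / Real.log (2 + V t ^ 2) ^ a) = g at *
    have e : 2 * g - 2 / (p + 1) * (g * (p + 1 - δ)) = g * (2 / (p + 1) * δ) := by
      field_simp
      ring
    rw [e, abs_of_nonneg (by positivity)]
    have : 2 / (p + 1) * δ ≤ ε * (p + 1 - δ) := by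
      have := mul_le_mul_of_nonneg_left hδ (by positivity : 0 ≤ 2 / (p + 1) + ε)
      linarith
    nlinarith [mul_le_mul_of_nonneg_left this hg]

lemma tendsto_neg_log_rpow_mul_speed {p a : ℝ} {V V' : ℝ → ℝ} (hp : 1 < p) (ha : 0 < a)
    {κ : ℝ} (hκ : 0 < κ)
    (hV : ∀ᶠ t in 𝓝[<] 0, HasDerivAt V (V' t) t)
    (hV' : ∀ᶠ t in 𝓝[<] 0, HasDerivAt V' (V t ^ p + f p a (V t)) t)
    (hmono : ∀ᶠ t in 𝓝[<] 0, 0 ≤ V' t)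
    (hlim : Tendsto (fun t => (-t) ^ (2 / (p - 1)) * V t) (𝓝[<] 0) (𝓝 κ)) :
    Tendsto (fun t => (-Real.log (-t)) ^ a *
        (V' t * V t ^ (-((p - 1) / 2) - 1) - √(2 / (p + 1))))
      (𝓝[<] 0) (𝓝 (√(2 / (p + 1)) / 2 * ((p - 1) / 4) ^ a)) := by
  have hp1 : 0 < p - 1 := by linarith
  have hq : 0 < 2 / (p - 1) := by positivity
  have htop := tendsto_atTop_of_neg_rpow_mul hq hκ hlim
  have hE := tendsto_log_rpow_mul_energy (by linarith) ha hV hV' hmono htop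
  have hσ := tendsto_neg_log_neg_nhdsLT_zero
  have hratio := (tendsto_log_two_add_sq_div hq hκ hlim).inv₀ (by positivity)
  have hratio' := hratio.rpow_const (p := a) (Or.inr ha.le)
  have hm : Tendsto (fun t => (-Real.log (-t)) ^ a * (V' t ^ 2 / V t ^ (p + 1) - 2 / (p + 1)))
      (𝓝[<] 0) (𝓝 (((2 * (2 / (p - 1)))⁻¹) ^ a * (2 / (p + 1)))) := by
    refine (hratio'.mul hE).congr' ?_
    filter_upwards [hσ.eventually_gt_atTop 0] with t ht
    have hL := log_two_add_sq_pos (V t)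
    rw [inv_div, Real.div_rpow ht.le hL.le]
    have := Real.rpow_pos_of_pos hL a
    field_simp
  have hσa : Tendsto (fun t : ℝ => (-Real.log (-t)) ^ a) (𝓝[<] 0) atTop :=
    (tendsto_rpow_atTop ha).comp hσ
  have hsq : Tendsto (fun t => V' t ^ 2 / V t ^ (p + 1)) (𝓝[<] 0) (𝓝 (2 / (p + 1))) :=
    tendsto_of_tendsto_mul_sub hσa hm
  have hl : 0 < 2 / (p + 1) := by positivity
  have hres := (Real.hasDerivAt_sqrt hl.ne').tendsto_mul_comp_sub hsq hm
  have hval : 1 / (2 * √(2 / (p + 1))) * (((2 * (2 / (p - 1)))⁻¹) ^ a * (2 / (p + 1))) =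
      √(2 / (p + 1)) / 2 * ((p - 1) / 4) ^ a := by
    have e : (2 * (2 / (p - 1)))⁻¹ = (p - 1) / 4 := by
      field_simp
      norm_num
    rw [e]
    have h1 := Real.sqrt_pos.2 hl
    nth_rewrite 2 [← Real.mul_self_sqrt hl.le]
    field_simp
  rw [hval] at hres
  refine hres.congr' ?_
  filter_upwards [hmono, htop.eventually_gt_atTop 0] with t h1 h2
  have e : V' t ^ 2 / V t ^ (p + 1) = (V' t * V t ^ (-((p - 1) / 2) - 1)) ^ 2 := by
    rw [mul_pow, ← Real.rpow_mul_natCast h2.le, div_eq_mul_inv, ← Real.rpow_neg h2.le]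
    congr 2
    push_cast
    ring
  rw [e, Real.sqrt_sq (by positivity)]

lemma tendsto_neg_log_rpow_mul_profile {p a : ℝ} {V V' : ℝ → ℝ} (hp : 1 < p) (ha : 0 < a)
    {κ : ℝ} (hκ : 0 < κ)
    (hV : ∀ᶠ t in 𝓝[<] 0, HasDerivAt V (V' t) t)
    (hV' : ∀ᶠ t in 𝓝[<] 0, HasDerivAt V' (V t ^ p + f p a (V t)) t)
    (hmono : ∀ᶠ t in 𝓝[<] 0, 0 ≤ V' t)
    (hlim : Tendsto (fun t => (-t) ^ (2 / (p - 1)) * V t) (𝓝[<] 0) (𝓝 κ)) :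
    Tendsto (fun t => (-Real.log (-t)) ^ a *
        (V t ^ (-((p - 1) / 2)) / (-t) - (p - 1) / 2 * √(2 / (p + 1))))
      (𝓝[<] 0) (𝓝 ((p - 1) / 2 * √(2 / (p + 1)) / 2 * ((p - 1) / 4) ^ a)) := by
  have hp1 : 0 < p - 1 := by linarith
  have htop := tendsto_atTop_of_neg_rpow_mul (by positivity) hκ hlim
  have hpos := htop.eventually_gt_atTop 0
  have hσ := tendsto_neg_log_neg_nhdsLT_zero
  have hspeed := tendsto_neg_log_rpow_mul_speed hp ha hκ hV hV' hmono hlim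
  have hneg : Tendsto (fun t : ℝ => -t) (𝓝[<] 0) (𝓝 0) :=
    tendsto_neg_nhdsLT_zero.mono_right nhdsWithin_le_nhds
  set l := √(2 / (p + 1)) with hl
  have key := HasDerivAt.lhopital_zero_nhdsLT (a := 0)
    (l := 𝓝 ((p - 1) / 2 * l / 2 * ((p - 1) / 4) ^ a))
    (f := fun t => V t ^ (-((p - 1) / 2)) - (p - 1) / 2 * l * (-t))
    (f' := fun t => (-((p - 1) / 2)) * (V' t * V t ^ (-((p - 1) / 2) - 1) - l))
    (g := fun t => (-t) * (-Real.log (-t)) ^ (-a))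
    (g' := fun t => -((-Real.log (-t)) ^ (-a) * (1 + a / (-Real.log (-t)))))
    ?_ ?_ ?_ ?_ ?_ ?_
  · refine key.congr' ?_
    filter_upwards [self_mem_nhdsWithin, hσ.eventually_gt_atTop 0] with t ht hs
    have ht : 0 < -t := neg_pos.2 ht
    rw [Real.rpow_neg hs.le]
    have := Real.rpow_pos_of_pos hs a
    have ht0 : t ≠ 0 := by linarith
    field_simp
    ring
  · filter_upwards [hV, hpos] with t h1 h2
    have := (h1.rpow_const (p := -((p - 1) / 2)) (Or.inl h2.ne')).sub
      ((hasDerivAt_id t).neg.const_mul ((p - 1) / 2 * l))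
    refine this.congr_deriv ?_
    ring
  · filter_upwards [self_mem_nhdsWithin, hσ.eventually_gt_atTop 0] with t ht hs
    have ht : 0 < -t := neg_pos.2 ht
    have h1 := (hasDerivAt_id t).neg
    have h2 := (h1.log ht.ne').neg.rpow_const (p := -a) (Or.inl hs.ne')
    refine (h1.mul h2).congr_deriv ?_
    simp only [Pi.neg_apply, id]
    rw [Real.rpow_sub hs, Real.rpow_one]
    have ht0 : t ≠ 0 := by linarith
    have : Real.log (-t) ≠ 0 := by linarith
    field_simp
    ring
  · filter_upwards [hσ.eventually_gt_atTop 0] with t hs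
    have := Real.rpow_pos_of_pos hs (-a)
    have : 0 < (-Real.log (-t)) ^ (-a) * (1 + a / (-Real.log (-t))) := by positivity
    linarith
  · have h1 := (tendsto_rpow_neg_atTop (y := (p - 1) / 2) (by positivity)).comp htop
    simpa using h1.sub (hneg.const_mul ((p - 1) / 2 * l))
  · simpa using hneg.mul ((tendsto_rpow_neg_atTop ha).comp hσ)
  · have h1 : Tendsto (fun t => (p - 1) / 2 / (1 + a / (-Real.log (-t)))) (𝓝[<] (0 : ℝ))
        (𝓝 ((p - 1) / 2 / (1 + 0))) :=
      tendsto_const_nhds.div (tendsto_const_nhds.add (hσ.const_div_atTop a)) (by norm_num)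
    have h2 := h1.mul hspeed
    have e : (p - 1) / 2 / (1 + 0) * (l / 2 * ((p - 1) / 4) ^ a) =
        (p - 1) / 2 * l / 2 * ((p - 1) / 4) ^ a := by ring
    rw [e] at h2
    refine h2.congr' ?_
    filter_upwards [hσ.eventually_gt_atTop 0] with t hs
    rw [Real.rpow_neg hs.le]
    have h3 := Real.rpow_pos_of_pos hs a
    have h4 : 0 < 1 + a / (-Real.log (-t)) := by positivity
    generalize 1 + a / (-Real.log (-t)) = d at *
    field_simp

lemma rpow_profile_eq_kappa0 {p : ℝ} (hp : 1 < p) :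
    ((p - 1) / 2 * √(2 / (p + 1))) ^ (-(2 / (p - 1))) = kappa0 p := by
  have hp1 : 0 < p - 1 := by linarith
  have hl : 0 < 2 / (p + 1) := by positivity
  have h1 := Real.sqrt_pos.2 hl
  rw [kappa0, show -(2 / (p - 1)) = (-2 : ℝ) * (1 / (p - 1)) by ring,
    Real.rpow_mul (by positivity), Real.rpow_neg (by positivity)]
  congr 1
  rw [Real.rpow_two, mul_pow, Real.sq_sqrt hl.le]
  field_simp

/-- for the similarity-variables solution `φ(s) = e^{-2s/(p-1)} φ₀(-e^{-s})`
coming from a nondecreasing positive blow-up solution `φ₀` of `φ₀'' = φ₀^p + f(φ₀)`,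
one has `φ(s) - κ₀ ∼ -(κ₀/(p-1)) ((p-1)/(4s))^a` as `s → ∞`, i.e.
`s^a (φ(s) - κ₀) → -κ₀ (p-1)^{a-1} / 4^a`. -/
theorem stmt_5 (p a t₀ : ℝ) (hp : 1 < p) (ha : 1 < a) (ht₀ : 0 < t₀)
    (φ₀ φ₀' φ₀'' : ℝ → ℝ)
    (hC : ContinuousOn φ₀'' (Set.Ico (-t₀) 0))
    (hd1 : ∀ t ∈ Set.Ico (-t₀) (0:ℝ), HasDerivWithinAt φ₀ (φ₀' t) (Set.Ico (-t₀) 0) t)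
    (hd2 : ∀ t ∈ Set.Ico (-t₀) (0:ℝ), HasDerivWithinAt φ₀' (φ₀'' t) (Set.Ico (-t₀) 0) t)
    (hpos : ∀ t ∈ Set.Ico (-t₀) (0:ℝ), 0 < φ₀ t)
    (hode : ∀ t ∈ Set.Ico (-t₀) (0:ℝ), φ₀'' t = φ₀ t ^ p + f p a (φ₀ t))
    (hmono : ∀ t ∈ Set.Ico (-t₀) (0:ℝ), 0 ≤ φ₀' t)
    (hlim : Filter.Tendsto (fun t => (-t) ^ (2 / (p - 1)) * φ₀ t)
      (nhdsWithin 0 (Set.Iio 0)) (nhds (kappa0 p)))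
    (φ : ℝ → ℝ)
    (hφ : ∀ s, φ s = Real.exp (-2 * s / (p - 1)) * φ₀ (-Real.exp (-s))) :
    Filter.Tendsto (fun s => s ^ a * (φ s - kappa0 p)) Filter.atTop
      (nhds (-(kappa0 p) * (p - 1) ^ (a - 1) / 4 ^ a)) := by
  have hp1 : 0 < p - 1 := by linarith
  have hl : 0 < √(2 / (p + 1)) := Real.sqrt_pos.2 (by positivity)
  have hκ : 0 < kappa0 p := Real.rpow_pos_of_pos (by positivity) _
  have hmem : ∀ᶠ t in 𝓝[<] (0 : ℝ), t ∈ Ioo (-t₀) 0 := Ioo_mem_nhdsLT (by linarith)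
  have hprof := tendsto_neg_log_rpow_mul_profile (V := φ₀) (V' := φ₀') hp (by linarith : 0 < a) hκ
    (hmem.mono fun t ht => (hd1 t (Ioo_subset_Ico_self ht)).hasDerivAt (Ico_mem_nhds ht.1 ht.2))
    (hmem.mono fun t ht => by
      rw [← hode t (Ioo_subset_Ico_self ht)]
      exact (hd2 t (Ioo_subset_Ico_self ht)).hasDerivAt (Ico_mem_nhds ht.1 ht.2))
    (hmem.mono fun t ht => hmono t (Ioo_subset_Ico_self ht)) hlim
  have hσa : Tendsto (fun t : ℝ => (-Real.log (-t)) ^ a) (𝓝[<] 0) atTop :=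
    (tendsto_rpow_atTop (by linarith)).comp tendsto_neg_log_neg_nhdsLT_zero
  have hb : 0 < (p - 1) / 2 * √(2 / (p + 1)) := by positivity
  have hmain := (Real.hasDerivAt_rpow_const (p := -(2 / (p - 1)))
    (Or.inl hb.ne')).tendsto_mul_comp_sub (tendsto_of_tendsto_mul_sub hσa hprof) hprof
  have hsub : Tendsto (fun s : ℝ => -Real.exp (-s)) atTop (𝓝[<] 0) := by
    refine tendsto_nhdsWithin_iff.2 ⟨?_, Eventually.of_forall fun s => ?_⟩
    · simpa using (Real.tendsto_exp_neg_atTop_nhds_zero).neg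
    · simpa using Real.exp_pos (-s)
  have hfin := hmain.comp hsub
  rw [Real.rpow_sub hb, Real.rpow_one, rpow_profile_eq_kappa0 hp] at hfin
  have hval : -(2 / (p - 1)) * (kappa0 p / ((p - 1) / 2 * √(2 / (p + 1)))) *
      ((p - 1) / 2 * √(2 / (p + 1)) / 2 * ((p - 1) / 4) ^ a) =
      -(kappa0 p) * (p - 1) ^ (a - 1) / 4 ^ a := by
    rw [Real.div_rpow hp1.le (by norm_num), Real.rpow_sub hp1, Real.rpow_one]
    field_simp
  rw [hval] at hfin
  refine hfin.congr' ?_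
  filter_upwards [hsub.eventually hmem] with s hs
  have hV := hpos _ (Ioo_subset_Ico_self hs)
  simp only [Function.comp, neg_neg, Real.log_exp]
  rw [hφ, Real.div_rpow (by positivity) (Real.exp_pos _).le, ← Real.rpow_mul hV.le,
    ← Real.exp_mul, show -((p - 1) / 2) * -(2 / (p - 1)) = 1 by field_simp, Real.rpow_one,
    div_eq_mul_inv, ← Real.exp_neg, mul_comm (φ₀ _)]
  congr 4
  ring
end

section
/- For every p > 1 there exists C > 0 such that for all x ≥ 0 and all q ∈ ℝ: | |x + q|^{p+1}/(p+1) - x^{p+1}/(p+1) - x^p q - (p/2) x^{p-1} q² | ≤ C (δ_{p≥2} · x^{p-2} |q|³ + |q|^{p+1}), where δ_{p≥2} equals 1 if p ≥ 2 and 0 if 1 < p < 2. -/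
open Filter Set

/-- A twice differentiable function vanishing to first order at `0`, with second derivative bounded
by `B` on `[-|q|, |q|]`, is bounded by `B * q ^ 2` at `q`. -/
lemma abs_le_mul_sq_of_abs_deriv_deriv_le {f f' f'' : ℝ → ℝ} {B q : ℝ}
    (hf : ∀ t, HasDerivAt f (f' t) t) (hf' : ∀ t, HasDerivAt f' (f'' t) t)
    (h0 : f 0 = 0) (h0' : f' 0 = 0) (hB : ∀ t, |t| ≤ |q| → |f'' t| ≤ B) :
    |f q| ≤ B * q ^ 2 := by
  have hB0 : 0 ≤ B := (abs_nonneg _).trans (hB q le_rfl)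
  have hconv : Convex ℝ (Metric.closedBall (0 : ℝ) |q|) := convex_closedBall _ _
  have hmem : ∀ {t : ℝ}, t ∈ Metric.closedBall (0 : ℝ) |q| ↔ |t| ≤ |q| := by
    intro t
    simp
  have hzero : (0 : ℝ) ∈ Metric.closedBall (0 : ℝ) |q| := hmem.2 (by simp)
  have hbound : ∀ t ∈ Metric.closedBall (0 : ℝ) |q|, ‖f' t‖ ≤ B * |q| := by
    intro t ht
    have h := hconv.norm_image_sub_le_of_norm_hasDerivWithin_le
      (fun s _ => (hf' s).hasDerivWithinAt) (fun s hs => hB s (hmem.1 hs)) hzero ht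
    rw [h0', sub_zero, sub_zero] at h
    exact h.trans (mul_le_mul_of_nonneg_left (hmem.1 ht) hB0)
  have h := hconv.norm_image_sub_le_of_norm_hasDerivWithin_le
    (fun s _ => (hf s).hasDerivWithinAt) hbound hzero (hmem.2 le_rfl)
  rw [h0, sub_zero, sub_zero, Real.norm_eq_abs, Real.norm_eq_abs, mul_assoc, ← sq, sq_abs] at h
  exact h

lemma hasDerivAt_abs_rpow_mul_self {r : ℝ} (hr : 0 < r) (s : ℝ) :
    HasDerivAt (fun s : ℝ => |s| ^ r * s) ((r + 1) * |s| ^ r) s := by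
  rcases eq_or_ne s 0 with rfl | hs
  · simp only [hasDerivAt_iff_tendsto_slope_zero, abs_zero, Real.zero_rpow hr.ne', mul_zero]
    have hcont : Tendsto (fun t : ℝ => |t| ^ r) (nhdsWithin 0 {0}ᶜ) (nhds 0) := by
      have h : Continuous fun t : ℝ => |t| ^ r :=
        continuous_abs.rpow_const fun _ => Or.inr hr.le
      have h' := h.tendsto 0
      rw [abs_zero, Real.zero_rpow hr.ne'] at h'
      exact h'.mono_left nhdsWithin_le_nhds
    refine hcont.congr' ?_
    filter_upwards [self_mem_nhdsWithin] with t ht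
    have ht0 : t ≠ 0 := ht
    simp only [zero_add, smul_eq_mul, sub_zero]
    field_simp
  · have hpos : 0 < |s| := abs_pos.2 hs
    have h := ((hasDerivAt_abs hs).rpow_const (p := r) (Or.inl hpos.ne')).mul (hasDerivAt_id s)
    refine h.congr_deriv ?_
    have hsign : (SignType.sign s : ℝ) * s = |s| := sign_mul_self s
    have hpow : |s| ^ (r - 1) * |s| = |s| ^ r := by
      rw [← Real.rpow_add_one hpos.ne', sub_add_cancel]
    simp only [id_eq]
    linear_combination r * |s| ^ (r - 1) * hsign + r * hpow

lemma abs_rpow_sub_rpow_le_of_le_one {a b r : ℝ} (ha : 0 ≤ a) (hb : 0 ≤ b) (hr : 0 ≤ r)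
    (hr1 : r ≤ 1) : |a ^ r - b ^ r| ≤ |a - b| ^ r := by
  wlog hab : b ≤ a generalizing a b
  · rw [abs_sub_comm, abs_sub_comm a]
    exact this hb ha (le_of_not_ge hab)
  have h := Real.rpow_add_le_add_rpow (sub_nonneg.2 hab) hb hr hr1
  rw [sub_add_cancel] at h
  rw [abs_of_nonneg (sub_nonneg.2 hab),
    abs_of_nonneg (sub_nonneg.2 (Real.rpow_le_rpow hb hab hr))]
  linarith

lemma abs_rpow_sub_rpow_le_of_one_le {a b M r : ℝ} (ha : 0 ≤ a) (hb : 0 ≤ b) (hr : 1 ≤ r)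
    (haM : a ≤ M) (hbM : b ≤ M) : |a ^ r - b ^ r| ≤ r * M ^ (r - 1) * |a - b| := by
  refine (convex_Icc (0 : ℝ) M).norm_image_sub_le_of_norm_hasDerivWithin_le
    (f := fun s : ℝ => s ^ r)
    (fun s _ => (Real.hasDerivAt_rpow_const (Or.inr hr)).hasDerivWithinAt) (fun s hs => ?_)
    ⟨hb, hbM⟩ ⟨ha, haM⟩
  rw [Real.norm_eq_abs, abs_of_nonneg (mul_nonneg (by linarith) (Real.rpow_nonneg hs.1 _))]
  exact mul_le_mul_of_nonneg_left (Real.rpow_le_rpow hs.1 hs.2 (by linarith)) (by linarith)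

lemma add_rpow_le_two_rpow_mul {a b r : ℝ} (ha : 0 ≤ a) (hb : 0 ≤ b) (hr : 0 ≤ r) :
    (a + b) ^ r ≤ 2 ^ r * (a ^ r + b ^ r) := by
  wlog hab : b ≤ a generalizing a b
  · rw [add_comm a, add_comm (a ^ r)]
    exact this hb ha (le_of_not_ge hab)
  calc (a + b) ^ r ≤ (2 * a) ^ r := Real.rpow_le_rpow (by linarith) (by linarith) hr
    _ = 2 ^ r * a ^ r := Real.mul_rpow zero_le_two ha
    _ ≤ 2 ^ r * (a ^ r + b ^ r) :=
      mul_le_mul_of_nonneg_left (le_add_of_nonneg_right (Real.rpow_nonneg hb r)) (by positivity)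

lemma exists_abs_rpow_sub_rpow_le {p : ℝ} (hp : 1 < p) :
    ∃ C : ℝ, 0 < C ∧ ∀ x : ℝ, 0 ≤ x → ∀ q : ℝ, |(|x + q| ^ (p - 1) - x ^ (p - 1))| ≤
      C * ((if 2 ≤ p then (1 : ℝ) else 0) * x ^ (p - 2) * |q| + |q| ^ (p - 1)) := by
  have hdiff : ∀ x : ℝ, 0 ≤ x → ∀ q : ℝ, |(|x + q| - x)| ≤ |q| := by
    intro x hx q
    simpa [abs_of_nonneg hx] using abs_abs_sub_abs_le_abs_sub (x + q) x
  by_cases h2 : 2 ≤ p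
  · refine ⟨(p - 1) * 2 ^ (p - 2), mul_pos (by linarith) (by positivity), fun x hx q => ?_⟩
    have hM : |x + q| ≤ x + |q| := by simpa [abs_of_nonneg hx] using abs_add_le x q
    have h := abs_rpow_sub_rpow_le_of_one_le (abs_nonneg (x + q)) hx (r := p - 1) (by linarith)
      hM (le_add_of_nonneg_right (abs_nonneg q))
    rw [show p - 1 - 1 = p - 2 by ring] at h
    have hpow : |q| ^ (p - 1) = |q| ^ (p - 2) * |q| := by
      rw [show p - 1 = p - 2 + 1 by ring,
        Real.rpow_add_one' (abs_nonneg q) (by linarith)]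
    have hp1 : 0 ≤ p - 1 := by linarith
    calc |(|x + q| ^ (p - 1) - x ^ (p - 1))|
        ≤ (p - 1) * (x + |q|) ^ (p - 2) * |(|x + q| - x)| := h
      _ ≤ (p - 1) * (2 ^ (p - 2) * (x ^ (p - 2) + |q| ^ (p - 2))) * |q| := by
        refine mul_le_mul (mul_le_mul_of_nonneg_left ?_ hp1) (hdiff x hx q) (abs_nonneg _)
          (by positivity)
        exact add_rpow_le_two_rpow_mul hx (abs_nonneg q) (by linarith)
      _ = _ := by
        rw [if_pos h2, hpow]
        ring
  · refine ⟨1, one_pos, fun x hx q => ?_⟩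
    rw [if_neg h2, zero_mul, zero_mul, zero_add, one_mul]
    exact (abs_rpow_sub_rpow_le_of_le_one (abs_nonneg _) hx (by linarith) (by linarith)).trans
      (Real.rpow_le_rpow (abs_nonneg _) (hdiff x hx q) (by linarith))

/-- cubic expansion estimate for the pure power potential:
`| |x+q|^{p+1}/(p+1) - x^{p+1}/(p+1) - x^p q - (p/2) x^{p-1} q² |
  ≤ C (δ_{p≥2} x^{p-2} |q|³ + |q|^{p+1})`. -/
theorem stmt_9 (p : ℝ) (hp : 1 < p) :
    ∃ C : ℝ, 0 < C ∧ ∀ x : ℝ, 0 ≤ x → ∀ q : ℝ,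
      |(|x + q| ^ (p + 1) / (p + 1) - x ^ (p + 1) / (p + 1)
          - x ^ p * q - p / 2 * x ^ (p - 1) * q ^ 2)| ≤
        C * ((if 2 ≤ p then (1:ℝ) else 0) * x ^ (p - 2) * |q| ^ 3 + |q| ^ (p + 1)) := by
  obtain ⟨C, hC, hbound⟩ := exists_abs_rpow_sub_rpow_le hp
  have hp0 : 0 < p := by linarith
  refine ⟨p * C, mul_pos hp0 hC, fun x hx q => ?_⟩
  have hderiv : ∀ t, HasDerivAt
      (fun t : ℝ => |x + t| ^ (p + 1) / (p + 1) - x ^ (p + 1) / (p + 1)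
        - x ^ p * t - p / 2 * x ^ (p - 1) * t ^ 2)
      (|x + t| ^ (p - 1) * (x + t) - x ^ p - p * x ^ (p - 1) * t) t := by
    intro t
    have h := ((hasDerivAt_abs_rpow (x + t) (p := p + 1) (by linarith)).comp_const_add x t).div_const
      (p + 1)
    refine (((h.sub_const (x ^ (p + 1) / (p + 1))).sub
      ((hasDerivAt_id t).const_mul (x ^ p))).sub
      ((hasDerivAt_pow 2 t).const_mul (p / 2 * x ^ (p - 1)))).congr_deriv ?_
    rw [show p + 1 - 2 = p - 1 by ring]
    have : p + 1 ≠ 0 := by linarith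
    field_simp
    norm_num
    ring
  have hderiv2 : ∀ t, HasDerivAt
      (fun t : ℝ => |x + t| ^ (p - 1) * (x + t) - x ^ p - p * x ^ (p - 1) * t)
      (p * (|x + t| ^ (p - 1) - x ^ (p - 1))) t := by
    intro t
    have h := (hasDerivAt_abs_rpow_mul_self (r := p - 1) (by linarith) (x + t)).comp_const_add x t
    refine ((h.sub_const (x ^ p)).sub
      ((hasDerivAt_id t).const_mul (p * x ^ (p - 1)))).congr_deriv ?_
    ring
  have hmul : ∀ y : ℝ, 0 ≤ y → y ^ (p - 1) * y = y ^ p := by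
    intro y hy
    rw [← Real.rpow_add_one' hy (by linarith), sub_add_cancel]
  have h := abs_le_mul_sq_of_abs_deriv_deriv_le (q := q)
    (B := p * C * ((if 2 ≤ p then (1 : ℝ) else 0) * x ^ (p - 2) * |q| + |q| ^ (p - 1)))
    hderiv hderiv2 (by simp [abs_of_nonneg hx]) (by simp [abs_of_nonneg hx, hmul x hx]) ?_
  · refine h.trans_eq ?_
    have hq : |q| ^ (p - 1) * |q| ^ 2 = |q| ^ (p + 1) := by
      rw [sq, ← mul_assoc, hmul _ (abs_nonneg q),
        Real.rpow_add_one' (abs_nonneg q) (by linarith)]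
    rw [← hq, ← sq_abs q]
    ring
  · intro t ht
    rw [abs_mul, abs_of_pos hp0, mul_assoc]
    refine mul_le_mul_of_nonneg_left ((hbound x hx t).trans ?_) hp0.le
    have hδ : (0 : ℝ) ≤ if 2 ≤ p then 1 else 0 := by split_ifs <;> norm_num
    have hr : 0 ≤ p - 1 := by linarith
    gcongr
end

section
/- For every p > 1 there exists C > 0 such that for all d₁, d₂ ∈ (-1, 1): ‖κ(d₁, ·) - κ(d₂, ·)‖_{H₀} ≤ C · (1/2) | log((1+d₁)/(1-d₁)) - log((1+d₂)/(1-d₂)) |, i.e. the map d ↦ κ(d, ·) is Lipschitz from (-1,1) equipped with the hyperbolic distance |artanh d₁ - artanh d₂| into H₀. -/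
open Filter Set

/-- The stationary solutions `κ(d,y) = κ₀ (1-d²)^{1/(p-1)} / (1+dy)^{2/(p-1)}`. -/
noncomputable def kappa (p d y : ℝ) : ℝ :=
  kappa0 p * (1 - d ^ 2) ^ (1 / (p - 1)) / (1 + d * y) ^ (2 / (p - 1))

/-- The weight `ρ(y) = (1-y²)^{2/(p-1)}`. -/
noncomputable def rho (p y : ℝ) : ℝ := (1 - y ^ 2) ^ (2 / (p - 1))

/-- The `H₀` norm: `‖r‖_{H₀}² = ∫_{-1}^1 ((r')²(1-y²) + r²) ρ dy`. -/
noncomputable def Hnorm (p : ℝ) (r : ℝ → ℝ) : ℝ :=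
  Real.sqrt (∫ y in Set.Ioo (-1:ℝ) 1, ((deriv r y) ^ 2 * (1 - y ^ 2) + r y ^ 2) * rho p y)

open MeasureTheory in
theorem sq_sub_le_mul_integral_sq {f f' : ℝ → ℝ} {s t : ℝ} (hst : s ≤ t)
    (hf : ∀ x, HasDerivAt f (f' x) x) (hf' : Continuous f') :
    (f t - f s) ^ 2 ≤ (t - s) * ∫ x in s..t, f' x ^ 2 := by
  rcases hst.eq_or_lt with rfl | hlt
  · simp
  have hI : ∫ x in s..t, f' x = f t - f s :=
    intervalIntegral.integral_eq_sub_of_hasDerivAt (fun x _ => hf x) (hf'.intervalIntegrable _ _)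
  set L := t - s with hL
  set I := f t - f s
  have hLpos : 0 < L := sub_pos.2 hlt
  have hnonneg : 0 ≤ ∫ x in s..t, (L * f' x - I) ^ 2 :=
    intervalIntegral.integral_nonneg hst fun x _ => sq_nonneg _
  have hexp : ∫ x in s..t, (L * f' x - I) ^ 2
      = L ^ 2 * (∫ x in s..t, f' x ^ 2) - 2 * L * I * I + I ^ 2 * L := by
    have heq : ∀ x, (L * f' x - I) ^ 2 = L ^ 2 * f' x ^ 2 - 2 * L * I * f' x + I ^ 2 := by
      intro x; ring
    simp_rw [heq]
    rw [intervalIntegral.integral_add, intervalIntegral.integral_sub,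
      intervalIntegral.integral_const_mul, intervalIntegral.integral_const_mul, hI,
      intervalIntegral.integral_const]
    · simp only [smul_eq_mul, ← hL]; ring
    all_goals exact Continuous.intervalIntegrable (by fun_prop) _ _
  rw [hexp] at hnonneg
  have : 0 ≤ L * (L * (∫ x in s..t, f' x ^ 2) - I ^ 2) := by nlinarith
  linarith [nonneg_of_mul_nonneg_right this hLpos]

open MeasureTheory in
theorem lintegral_sq_sub_mul_le {h h' : ℝ → ℝ → ℝ} {w : ℝ → ℝ} {S : Set ℝ} {K : ENNReal}
    (hS : MeasurableSet S) (hw : ∀ y ∈ S, 0 ≤ w y)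
    (hh : ∀ y ∈ S, ∀ x, HasDerivAt (fun x => h x y) (h' x y) x)
    (hc : ∀ y ∈ S, Continuous fun x => h' x y)
    (hm : Measurable fun z : ℝ × ℝ => ENNReal.ofReal (h' z.1 z.2 ^ 2 * w z.2))
    (hK : ∀ x, ∫⁻ y in S, ENNReal.ofReal (h' x y ^ 2 * w y) ≤ K) (s t : ℝ) :
    ∫⁻ y in S, ENNReal.ofReal ((h s y - h t y) ^ 2 * w y) ≤ ENNReal.ofReal ((s - t) ^ 2) * K := by
  wlog hst : s ≤ t generalizing s t
  · have := this t s (le_of_not_ge hst)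
    simpa only [sub_sq_comm] using this
  calc ∫⁻ y in S, ENNReal.ofReal ((h s y - h t y) ^ 2 * w y)
      ≤ ∫⁻ y in S, ENNReal.ofReal (t - s) *
          ∫⁻ x in Ioc s t, ENNReal.ofReal (h' x y ^ 2 * w y) := by
        refine setLIntegral_mono' hS fun y hy => ?_
        have hcont : Continuous fun x => h' x y ^ 2 * w y := ((hc y hy).pow 2).mul_const _
        rw [← ofReal_integral_eq_lintegral_ofReal
          ((hcont.integrableOn_Icc (a := s) (b := t)).mono_set Ioc_subset_Icc_self)
          (Eventually.of_forall fun x => mul_nonneg (sq_nonneg _) (hw y hy)),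
          ← ENNReal.ofReal_mul (sub_nonneg.2 hst), integral_mul_const,
          ← intervalIntegral.integral_of_le hst, ← mul_assoc, sub_sq_comm]
        exact ENNReal.ofReal_le_ofReal (mul_le_mul_of_nonneg_right
          (sq_sub_le_mul_integral_sq hst (hh y hy) (hc y hy)) (hw y hy))
    _ = ENNReal.ofReal (t - s) *
          ∫⁻ x in Ioc s t, ∫⁻ y in S, ENNReal.ofReal (h' x y ^ 2 * w y) := by
        rw [lintegral_const_mul' _ _ ENNReal.ofReal_ne_top, lintegral_lintegral_swap]
        exact (hm.comp measurable_swap).aemeasurable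
    _ ≤ ENNReal.ofReal (t - s) * ∫⁻ _ in Ioc s t, K := by gcongr; exact hK _
    _ = ENNReal.ofReal ((s - t) ^ 2) * K := by
        rw [setLIntegral_const, Real.volume_Ioc, mul_comm K, ← mul_assoc,
          ← ENNReal.ofReal_mul (sub_nonneg.2 hst), ← sq, sub_sq_comm]

open MeasureTheory in
theorem lintegral_ofReal_deriv_of_nonneg {G G' : ℝ → ℝ} {a b : ℝ} (hab : a ≤ b)
    (hc : ContinuousOn G (Icc a b)) (hG : ∀ x ∈ Ioo a b, HasDerivAt G (G' x) x)
    (hG' : ∀ x ∈ Ioo a b, 0 ≤ G' x) :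
    ∫⁻ x in Ioo a b, ENNReal.ofReal (G' x) = ENNReal.ofReal (G b - G a) := by
  have hint := intervalIntegral.integrableOn_deriv_of_nonneg hc hG hG'
  rw [← intervalIntegral.integral_eq_sub_of_hasDerivAt_of_le hab hc hG
    ((intervalIntegrable_iff_integrableOn_Ioc_of_le hab).2 hint),
    intervalIntegral.integral_of_le hab, integral_Ioc_eq_integral_Ioo,
    ofReal_integral_eq_lintegral_ofReal (hint.mono_set Ioo_subset_Ioc_self)
    (ae_restrict_of_forall_mem measurableSet_Ioo hG')]

/-- The denominator of `kappa` in rapidity coordinates: `cosh x * (1 + tanh x * y)`. -/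
noncomputable def boostDen (x y : ℝ) : ℝ := Real.cosh x + y * Real.sinh x

/-- The derivative of `boostDen` in the rapidity. -/
noncomputable def boostNum (x y : ℝ) : ℝ := Real.sinh x + y * Real.cosh x

theorem boostDen_add_boostNum (x y : ℝ) :
    boostDen x y + boostNum x y = Real.exp x * (1 + y) := by
  rw [boostDen, boostNum, ← Real.cosh_add_sinh]; ring

theorem boostDen_sub_boostNum (x y : ℝ) :
    boostDen x y - boostNum x y = Real.exp (-x) * (1 - y) := by
  rw [boostDen, boostNum, ← Real.cosh_sub_sinh]; ring

theorem boostDen_pos {x y : ℝ} (hy : y ∈ Icc (-1 : ℝ) 1) : 0 < boostDen x y := by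
  have h₁ := boostDen_add_boostNum x y
  have h₂ := boostDen_sub_boostNum x y
  have e₁ := Real.exp_pos x
  have e₂ := Real.exp_pos (-x)
  have h₃ := mul_nonneg e₁.le (by linarith [hy.1] : (0 : ℝ) ≤ 1 + y)
  have h₄ := mul_nonneg e₂.le (by linarith [hy.2] : (0 : ℝ) ≤ 1 - y)
  rcases le_total y 0 with h | h
  · nlinarith
  · nlinarith

theorem abs_boostNum_le {x y : ℝ} (hy : y ∈ Icc (-1 : ℝ) 1) : |boostNum x y| ≤ boostDen x y := by
  have h₁ := boostDen_add_boostNum x y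
  have h₂ := boostDen_sub_boostNum x y
  have h₃ := mul_nonneg (Real.exp_pos x).le (by linarith [hy.1] : (0 : ℝ) ≤ 1 + y)
  have h₄ := mul_nonneg (Real.exp_pos (-x)).le (by linarith [hy.2] : (0 : ℝ) ≤ 1 - y)
  exact abs_le.2 ⟨by linarith, by linarith⟩

theorem boostDen_sq_sub_boostNum_sq (x y : ℝ) :
    boostDen x y ^ 2 - boostNum x y ^ 2 = 1 - y ^ 2 := by
  have := Real.cosh_sq x
  rw [boostDen, boostNum]
  linear_combination (1 - y ^ 2) * this

theorem abs_sinh_le_cosh (x : ℝ) : |Real.sinh x| ≤ Real.cosh x := by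
  rw [← Real.cosh_abs x, Real.abs_sinh]; exact (Real.sinh_lt_cosh _).le

theorem one_sub_sq_mul_cosh_le (x y : ℝ) :
    (1 - y ^ 2) * Real.cosh x ≤ 2 * boostDen x y := by
  have := abs_le.1 (abs_sinh_le_cosh x)
  rw [boostDen]
  nlinarith [mul_nonneg (sq_nonneg (1 + y)) (by linarith : 0 ≤ Real.cosh x + Real.sinh x),
    mul_nonneg (sq_nonneg (1 - y)) (by linarith : 0 ≤ Real.cosh x - Real.sinh x)]

theorem hasDerivAt_boostDen_left (x y : ℝ) :
    HasDerivAt (fun x => boostDen x y) (boostNum x y) x :=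
  (Real.hasDerivAt_cosh x).add ((Real.hasDerivAt_sinh x).const_mul y)

theorem hasDerivAt_boostDen_right (x y : ℝ) :
    HasDerivAt (fun y => boostDen x y) (Real.sinh x) y := by
  simpa [boostDen] using ((hasDerivAt_id y).mul_const (Real.sinh x)).const_add (Real.cosh x)

theorem hasDerivAt_boostNum_right (x y : ℝ) :
    HasDerivAt (fun y => boostNum x y) (Real.cosh x) y := by
  simpa [boostNum] using ((hasDerivAt_id y).mul_const (Real.cosh x)).const_add (Real.sinh x)

theorem lintegral_boost_rpow {c x : ℝ} (hc : 0 < c) :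
    ∫⁻ y in Ioo (-1 : ℝ) 1, ENNReal.ofReal
      (((1 + boostNum x y / boostDen x y) ^ (c - 1) + (1 - boostNum x y / boostDen x y) ^ (c - 1)) /
        boostDen x y ^ 2) = ENNReal.ofReal (2 * (2 ^ c / c)) := by
  set Z : ℝ → ℝ := fun y => boostNum x y / boostDen x y with hZ
  have hbound : ∀ y ∈ Ioo (-1 : ℝ) 1, 0 < 1 + Z y ∧ 0 < 1 - Z y := by
    intro y hy
    have hN : 0 < boostDen x y := boostDen_pos (Ioo_subset_Icc_self hy)
    have e₁ := mul_pos (Real.exp_pos x) (by linarith [hy.1] : 0 < 1 + y)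
    have e₂ := mul_pos (Real.exp_pos (-x)) (by linarith [hy.2] : 0 < 1 - y)
    rw [← boostDen_add_boostNum] at e₁
    rw [← boostDen_sub_boostNum] at e₂
    constructor
    · rw [hZ]; rw [show 1 + boostNum x y / boostDen x y
        = (boostDen x y + boostNum x y) / boostDen x y by field_simp]
      positivity
    · rw [hZ]; rw [show 1 - boostNum x y / boostDen x y
        = (boostDen x y - boostNum x y) / boostDen x y by field_simp]
      positivity
  have hderiv : ∀ y ∈ Icc (-1 : ℝ) 1, HasDerivAt Z (1 / boostDen x y ^ 2) y := by
    intro y hy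
    refine ((hasDerivAt_boostNum_right x y).div (hasDerivAt_boostDen_right x y)
      (boostDen_pos hy).ne').congr_deriv ?_
    congr 1
    simp only [boostDen, boostNum]
    linear_combination Real.cosh_sq x
  have hZc : ContinuousOn Z (Icc (-1) 1) := fun y hy =>
    (hderiv y hy).continuousAt.continuousWithinAt
  have hZ1 : Z 1 = 1 := by
    have := (boostDen_pos (x := x) (y := 1) (by simp)).ne'
    rw [hZ]; simp only; rw [div_eq_one_iff_eq this, boostDen, boostNum]; ring
  have hZ2 : Z (-1) = -1 := by
    have := (boostDen_pos (x := x) (y := -1) (by simp)).ne'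
    rw [hZ]; simp only; rw [div_eq_iff this, boostDen, boostNum]; ring
  have key := lintegral_ofReal_deriv_of_nonneg (a := -1) (b := 1)
    (G := fun y => ((1 + Z y) ^ c - (1 - Z y) ^ c) / c)
    (G' := fun y => ((1 + Z y) ^ (c - 1) + (1 - Z y) ^ (c - 1)) / boostDen x y ^ 2) (by norm_num)
    (((((continuousOn_const.add hZc).rpow_const fun _ _ => Or.inr hc.le)).sub
      ((continuousOn_const.sub hZc).rpow_const fun _ _ => Or.inr hc.le)).div_const _) ?_ ?_
  · rw [key]
    simp only [hZ1, hZ2]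
    congr 1
    norm_num [Real.zero_rpow hc.ne']
    ring
  · intro y hy
    have hb := hbound y hy
    have hd := hderiv y (Ioo_subset_Icc_self hy)
    refine ((((hd.const_add 1).rpow_const (p := c) (Or.inl hb.1.ne')).sub
      ((hd.const_sub 1).rpow_const (p := c) (Or.inl hb.2.ne'))).div_const c).congr_deriv ?_
    field_simp
    ring
  · intro y hy
    have hb := hbound y hy
    exact div_nonneg (add_nonneg (Real.rpow_nonneg hb.1.le _) (Real.rpow_nonneg hb.2.le _))
      (sq_nonneg _)

theorem mul_rpow_le_add_rpow {u v b : ℝ} (hu : 0 < u) (hv : 0 < v) (huv : u + v = 2) :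
    (u * v) ^ (b - 1) ≤ u ^ (min b 1 - 1) + v ^ (min b 1 - 1) := by
  have h1 : u * v ≤ 1 := by nlinarith [sq_nonneg (u - v)]
  have hc : min b 1 - 1 ≤ 0 := by linarith [min_le_right b 1]
  refine (Real.rpow_le_rpow_of_exponent_ge (mul_pos hu hv) h1
    (by linarith [min_le_left b 1] : min b 1 - 1 ≤ b - 1)).trans ?_
  rw [Real.mul_rpow hu.le hv.le]
  have pu := Real.rpow_pos_of_pos hu (min b 1 - 1)
  have pv := Real.rpow_pos_of_pos hv (min b 1 - 1)
  rcases le_total 1 u with h | h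
  · nlinarith [Real.rpow_le_one_of_one_le_of_nonpos h hc]
  · nlinarith [Real.rpow_le_one_of_one_le_of_nonpos (by linarith : 1 ≤ v) hc]

theorem kappa_tanh {p x y : ℝ} (hy : y ∈ Icc (-1 : ℝ) 1) :
    kappa p (Real.tanh x) y = kappa0 p * boostDen x y ^ (-(2 / (p - 1))) := by
  have hN := boostDen_pos (x := x) hy
  have hc := Real.cosh_pos x
  have h1 : 1 - Real.tanh x ^ 2 = (Real.cosh x ^ 2)⁻¹ := by
    rw [Real.tanh_eq_sinh_div_cosh]
    field_simp
    linarith [Real.cosh_sq x]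
  have h2 : 1 + Real.tanh x * y = boostDen x y / Real.cosh x := by
    rw [Real.tanh_eq_sinh_div_cosh, boostDen]
    field_simp
  rw [kappa, h1, h2, Real.inv_rpow (by positivity), ← Real.rpow_natCast, ← Real.rpow_mul hc.le,
    Real.div_rpow hN.le hc.le, Real.rpow_neg hN.le,
    show ((2 : ℕ) : ℝ) * (1 / (p - 1)) = 2 / (p - 1) by push_cast; ring]
  have := Real.rpow_pos_of_pos hN (2 / (p - 1))
  have := Real.rpow_pos_of_pos hc (2 / (p - 1))
  field_simp

theorem deriv_kappa_tanh_sub {p s t y : ℝ} (hy : y ∈ Ioo (-1 : ℝ) 1) :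
    deriv (fun y => kappa p (Real.tanh s) y - kappa p (Real.tanh t) y) y =
      kappa0 p * (Real.sinh s * -(2 / (p - 1)) * boostDen s y ^ (-(2 / (p - 1)) - 1)) -
      kappa0 p * (Real.sinh t * -(2 / (p - 1)) * boostDen t y ^ (-(2 / (p - 1)) - 1)) := by
  have h : ∀ x, HasDerivAt (fun y => kappa p (Real.tanh x) y)
      (kappa0 p * (Real.sinh x * -(2 / (p - 1)) * boostDen x y ^ (-(2 / (p - 1)) - 1))) y := by
    intro x
    refine ((((hasDerivAt_boostDen_right x y).rpow_const
      (Or.inl (boostDen_pos (Ioo_subset_Icc_self hy)).ne')).const_mul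
        (kappa0 p))).congr_of_eventuallyEq ?_
    filter_upwards [Ioo_mem_nhds hy.1 hy.2] with z hz
    exact kappa_tanh (Ioo_subset_Icc_self hz)
  exact ((h s).sub (h t)).deriv

theorem continuous_boostDen_left (y : ℝ) : Continuous fun x => boostDen x y := by
  unfold boostDen; fun_prop

theorem continuous_boostNum_left (y : ℝ) : Continuous fun x => boostNum x y := by
  unfold boostNum; fun_prop

theorem lintegral_sq_rpow_sub_le {b : ℝ} (hb : 0 < b) (s t : ℝ) :
    ∫⁻ y in Ioo (-1 : ℝ) 1, ENNReal.ofReal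
      ((boostDen s y ^ (-b) - boostDen t y ^ (-b)) ^ 2 * (1 - y ^ 2) ^ b) ≤
      ENNReal.ofReal ((s - t) ^ 2) * ENNReal.ofReal (2 * b ^ 2) := by
  refine lintegral_sq_sub_mul_le (h := fun x y => boostDen x y ^ (-b))
    (h' := fun x y => boostNum x y * (-b) * boostDen x y ^ (-b - 1))
    (w := fun y => (1 - y ^ 2) ^ b) measurableSet_Ioo ?_ ?_ ?_ ?_ ?_ s t
  · intro y hy
    exact Real.rpow_nonneg (by nlinarith [hy.1, hy.2]) _
  · intro y hy x
    exact (hasDerivAt_boostDen_left x y).rpow_const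
      (Or.inl (boostDen_pos (Ioo_subset_Icc_self hy)).ne')
  · intro y hy
    exact ((continuous_boostNum_left y).mul_const _).mul ((continuous_boostDen_left y).rpow_const
      fun x => Or.inl (boostDen_pos (Ioo_subset_Icc_self hy)).ne')
  · unfold boostNum boostDen; fun_prop
  · intro x
    calc _ ≤ ∫⁻ y in Ioo (-1 : ℝ) 1, ENNReal.ofReal (b ^ 2) := by
          refine MeasureTheory.setLIntegral_mono' measurableSet_Ioo fun y hy =>
            ENNReal.ofReal_le_ofReal ?_
          have hN := boostDen_pos (x := x) (Ioo_subset_Icc_self hy)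
          have hM := sq_le_sq.2 ((abs_boostNum_le (x := x) (Ioo_subset_Icc_self hy)).trans
            (le_abs_self _))
          have hw : 0 ≤ 1 - y ^ 2 := by nlinarith [hy.1, hy.2]
          have hwN : (1 - y ^ 2) ^ b ≤ (boostDen x y ^ b) ^ 2 := by
            rw [Real.rpow_pow_comm hN.le]
            exact Real.rpow_le_rpow hw (by
              nlinarith [boostDen_sq_sub_boostNum_sq x y, sq_nonneg (boostNum x y)]) hb.le
          have hNb := Real.rpow_pos_of_pos hN b
          rw [Real.rpow_sub_one hN.ne', Real.rpow_neg hN.le]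
          calc _ ≤ (boostNum x y * -b * ((boostDen x y ^ b)⁻¹ / boostDen x y)) ^ 2 *
                (boostDen x y ^ b) ^ 2 := by gcongr
            _ = b ^ 2 * (boostNum x y ^ 2 / boostDen x y ^ 2) := by field_simp
            _ ≤ b ^ 2 * 1 := by
                gcongr
                exact div_le_one_of_le₀ hM (sq_nonneg _)
            _ = b ^ 2 := mul_one _
      _ = ENNReal.ofReal (2 * b ^ 2) := by
          rw [MeasureTheory.setLIntegral_const, Real.volume_Ioo, mul_comm,
            ← ENNReal.ofReal_mul (by norm_num)]
          norm_num

theorem mixed_deriv_sq_mul_le {b x y : ℝ} (hb : 0 < b) (hy : y ∈ Ioo (-1 : ℝ) 1) :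
    (Real.cosh x * boostDen x y ^ (-b - 1) +
      Real.sinh x * (boostNum x y * (-b - 1) * boostDen x y ^ (-b - 1 - 1))) ^ 2 *
      ((1 - y ^ 2) * (1 - y ^ 2) ^ b) ≤
    4 * (b + 2) ^ 2 * (((1 + boostNum x y / boostDen x y) ^ (min b 1 - 1) +
      (1 - boostNum x y / boostDen x y) ^ (min b 1 - 1)) / boostDen x y ^ 2) := by
  have hy' := Ioo_subset_Icc_self hy
  have hw : 0 < 1 - y ^ 2 := by nlinarith [hy.1, hy.2]
  have hN := boostDen_pos (x := x) hy'
  have hMN := boostDen_sq_sub_boostNum_sq x y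
  have hM := abs_boostNum_le (x := x) hy'
  have hwc := one_sub_sq_mul_cosh_le x y
  have hc := Real.cosh_pos x
  have hs := abs_sinh_le_cosh x
  set N := boostDen x y
  set M := boostNum x y
  have hM2 : |M| < N := abs_lt_of_sq_lt_sq (by linarith) hN.le
  have hu : 0 < 1 + M / N := by
    have : 0 < (N + M) / N := div_pos (by linarith [(abs_lt.1 hM2).1]) hN
    rwa [add_div, div_self hN.ne'] at this
  have hv : 0 < 1 - M / N := by
    have : 0 < (N - M) / N := div_pos (by linarith [(abs_lt.1 hM2).2]) hN
    rwa [sub_div, div_self hN.ne'] at this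
  have huv : (1 + M / N) * (1 - M / N) = (1 - y ^ 2) / N ^ 2 := by
    rw [← hMN]; field_simp; ring
  have key := mul_rpow_le_add_rpow (b := b) hu hv (by ring)
  rw [huv] at key
  have hlin : (Real.cosh x * N ^ (-b - 1) + Real.sinh x * (M * (-b - 1) * N ^ (-b - 1 - 1)))
      = (Real.cosh x * N - (b + 1) * (Real.sinh x * M)) * N ^ (-b - 2) := by
    rw [show -b - 1 = (-b - 2) + 1 by ring, Real.rpow_add_one hN.ne']
    ring_nf
  have hfac : (Real.cosh x * N - (b + 1) * (Real.sinh x * M)) ^ 2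
      ≤ ((b + 2) * (Real.cosh x * N)) ^ 2 := by
    have hsm : |Real.sinh x * M| ≤ Real.cosh x * N := by
      rw [abs_mul]; exact mul_le_mul hs hM (abs_nonneg _) hc.le
    have h₁ := mul_le_mul_of_nonneg_left (abs_le.1 hsm).1 (by linarith : 0 ≤ b + 1)
    have h₂ := mul_le_mul_of_nonneg_left (abs_le.1 hsm).2 (by linarith : 0 ≤ b + 1)
    refine sq_le_sq' (by nlinarith [mul_pos hc hN]) (by nlinarith [mul_pos hc hN])
  have hwc2 : ((1 - y ^ 2) * Real.cosh x) ^ 2 ≤ (2 * N) ^ 2 :=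
    pow_le_pow_left₀ (by positivity) hwc 2
  have hpow : (1 - y ^ 2) ^ b = (1 - y ^ 2) ^ (b - 1) * (1 - y ^ 2) := by
    rw [Real.rpow_sub_one hw.ne', div_mul_cancel₀ _ hw.ne']
  have hNpow : ((1 - y ^ 2) / N ^ 2) ^ (b - 1) / N ^ 2
      = (1 - y ^ 2) ^ (b - 1) * N ^ 4 * (N ^ (-b - 2)) ^ 2 := by
    rw [Real.div_rpow hw.le (by positivity), ← Real.rpow_natCast N 2, ← Real.rpow_mul hN.le,
      ← Real.rpow_natCast N 4, ← Real.rpow_natCast (N ^ (-b - 2)) 2, ← Real.rpow_mul hN.le,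
      div_div, ← Real.rpow_add hN, mul_assoc, ← Real.rpow_add hN, div_eq_mul_inv,
      ← Real.rpow_neg hN.le]
    congr 2
    push_cast
    ring
  calc _ = (Real.cosh x * N - (b + 1) * (Real.sinh x * M)) ^ 2 * (N ^ (-b - 2)) ^ 2 *
        ((1 - y ^ 2) ^ 2 * (1 - y ^ 2) ^ (b - 1)) := by rw [hlin, hpow]; ring
    _ ≤ ((b + 2) * (Real.cosh x * N)) ^ 2 * (N ^ (-b - 2)) ^ 2 *
        ((1 - y ^ 2) ^ 2 * (1 - y ^ 2) ^ (b - 1)) := by gcongr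
    _ = (b + 2) ^ 2 * N ^ 2 * (N ^ (-b - 2)) ^ 2 * (1 - y ^ 2) ^ (b - 1) *
        ((1 - y ^ 2) * Real.cosh x) ^ 2 := by ring
    _ ≤ (b + 2) ^ 2 * N ^ 2 * (N ^ (-b - 2)) ^ 2 * (1 - y ^ 2) ^ (b - 1) * (2 * N) ^ 2 := by gcongr
    _ = 4 * (b + 2) ^ 2 * (((1 - y ^ 2) / N ^ 2) ^ (b - 1) / N ^ 2) := by rw [hNpow]; ring
    _ ≤ _ := by gcongr

theorem lintegral_sq_sinh_rpow_sub_le {b : ℝ} (hb : 0 < b) (s t : ℝ) :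
    ∫⁻ y in Ioo (-1 : ℝ) 1, ENNReal.ofReal
      ((Real.sinh s * boostDen s y ^ (-b - 1) - Real.sinh t * boostDen t y ^ (-b - 1)) ^ 2 *
        ((1 - y ^ 2) * (1 - y ^ 2) ^ b)) ≤
      ENNReal.ofReal ((s - t) ^ 2) *
        ENNReal.ofReal (4 * (b + 2) ^ 2 * (2 * (2 ^ (min b 1) / min b 1))) := by
  refine lintegral_sq_sub_mul_le (h := fun x y => Real.sinh x * boostDen x y ^ (-b - 1))
    (h' := fun x y => Real.cosh x * boostDen x y ^ (-b - 1) +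
      Real.sinh x * (boostNum x y * (-b - 1) * boostDen x y ^ (-b - 1 - 1)))
    (w := fun y => (1 - y ^ 2) * (1 - y ^ 2) ^ b) measurableSet_Ioo ?_ ?_ ?_ ?_ ?_ s t
  · intro y hy
    have : 0 < 1 - y ^ 2 := by nlinarith [hy.1, hy.2]
    positivity
  · intro y hy x
    exact (Real.hasDerivAt_sinh x).mul ((hasDerivAt_boostDen_left x y).rpow_const
      (Or.inl (boostDen_pos (Ioo_subset_Icc_self hy)).ne'))
  · intro y hy
    have hr : ∀ q : ℝ, Continuous fun x => boostDen x y ^ q := fun q =>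
      (continuous_boostDen_left y).rpow_const
        fun x => Or.inl (boostDen_pos (Ioo_subset_Icc_self hy)).ne'
    exact (Real.continuous_cosh.mul (hr _)).add (Real.continuous_sinh.mul
      (((continuous_boostNum_left y).mul_const _).mul (hr _)))
  · unfold boostNum boostDen; fun_prop
  · intro x
    rw [ENNReal.ofReal_mul (by positivity), ← lintegral_boost_rpow (x := x) (lt_min hb one_pos),
      ← MeasureTheory.lintegral_const_mul' _ _ ENNReal.ofReal_ne_top]
    refine MeasureTheory.setLIntegral_mono' measurableSet_Ioo fun y hy => ?_
    rw [← ENNReal.ofReal_mul (by positivity)]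
    exact ENNReal.ofReal_le_ofReal (mixed_deriv_sq_mul_le hb hy)

open MeasureTheory in
theorem exists_lintegral_kappa_tanh_sub_le {p : ℝ} (hp : 1 < p) :
    ∃ K : ℝ, 0 < K ∧ ∀ s t : ℝ, ∫⁻ y in Ioo (-1 : ℝ) 1, ENNReal.ofReal
      (((deriv (fun y => kappa p (Real.tanh s) y - kappa p (Real.tanh t) y) y) ^ 2 * (1 - y ^ 2) +
        (kappa p (Real.tanh s) y - kappa p (Real.tanh t) y) ^ 2) * rho p y) ≤
      ENNReal.ofReal ((s - t) ^ 2 * K) := by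
  have hb : 0 < 2 / (p - 1) := div_pos two_pos (by linarith)
  have hk : 0 < kappa0 p := by
    have : 0 < p - 1 := by linarith
    unfold kappa0; positivity
  set b := 2 / (p - 1) with hbdef
  have hmin : 0 < min b 1 := lt_min hb one_pos
  set A := 4 * (b + 2) ^ 2 * (2 * (2 ^ (min b 1) / min b 1))
  have hA0 : 0 < A := by positivity
  refine ⟨(kappa0 p * b) ^ 2 * A + kappa0 p ^ 2 * (2 * b ^ 2), by positivity, fun s t => ?_⟩
  calc _ = ∫⁻ y in Ioo (-1 : ℝ) 1, (ENNReal.ofReal ((kappa0 p * b) ^ 2) * ENNReal.ofReal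
        ((Real.sinh s * boostDen s y ^ (-b - 1) - Real.sinh t * boostDen t y ^ (-b - 1)) ^ 2 *
        ((1 - y ^ 2) * (1 - y ^ 2) ^ b)) + ENNReal.ofReal (kappa0 p ^ 2) * ENNReal.ofReal
        ((boostDen s y ^ (-b) - boostDen t y ^ (-b)) ^ 2 * (1 - y ^ 2) ^ b)) := by
        refine setLIntegral_congr_fun measurableSet_Ioo fun y hy => ?_
        have hw : 0 < 1 - y ^ 2 := by nlinarith [hy.1, hy.2]
        rw [deriv_kappa_tanh_sub hy, kappa_tanh (Ioo_subset_Icc_self hy),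
          kappa_tanh (Ioo_subset_Icc_self hy), rho, ← hbdef, ← ENNReal.ofReal_mul (by positivity),
          ← ENNReal.ofReal_mul (by positivity), ← ENNReal.ofReal_add (by positivity)
          (by positivity)]
        congr 1
        ring
    _ = ENNReal.ofReal ((kappa0 p * b) ^ 2) * (∫⁻ y in Ioo (-1 : ℝ) 1, ENNReal.ofReal
        ((Real.sinh s * boostDen s y ^ (-b - 1) - Real.sinh t * boostDen t y ^ (-b - 1)) ^ 2 *
        ((1 - y ^ 2) * (1 - y ^ 2) ^ b))) + ENNReal.ofReal (kappa0 p ^ 2) *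
        ∫⁻ y in Ioo (-1 : ℝ) 1, ENNReal.ofReal
        ((boostDen s y ^ (-b) - boostDen t y ^ (-b)) ^ 2 * (1 - y ^ 2) ^ b) := by
        rw [lintegral_add_left (by unfold boostDen; fun_prop),
          lintegral_const_mul' _ _ ENNReal.ofReal_ne_top,
          lintegral_const_mul' _ _ ENNReal.ofReal_ne_top]
    _ ≤ ENNReal.ofReal ((kappa0 p * b) ^ 2) * (ENNReal.ofReal ((s - t) ^ 2) * ENNReal.ofReal A) +
        ENNReal.ofReal (kappa0 p ^ 2) *
          (ENNReal.ofReal ((s - t) ^ 2) * ENNReal.ofReal (2 * b ^ 2)) := by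
        gcongr
        · exact lintegral_sq_sinh_rpow_sub_le hb s t
        · exact lintegral_sq_rpow_sub_le hb s t
    _ = _ := by
        rw [← ENNReal.ofReal_mul (by positivity), ← ENNReal.ofReal_mul (by positivity),
          ← ENNReal.ofReal_mul (by positivity), ← ENNReal.ofReal_mul (by positivity),
          ← ENNReal.ofReal_add (by positivity) (by positivity)]
        congr 1
        ring

open MeasureTheory in
theorem integral_le_of_lintegral_ofReal_le {α : Type*} [MeasurableSpace α] {μ : Measure α}
    {f : α → ℝ} {B : ℝ} (hf : 0 ≤ᵐ[μ] f) (hB : 0 ≤ B)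
    (h : ∫⁻ a, ENNReal.ofReal (f a) ∂μ ≤ ENNReal.ofReal B) : ∫ a, f a ∂μ ≤ B := by
  by_cases hi : Integrable f μ
  · rwa [← ofReal_integral_eq_lintegral_ofReal hi hf, ENNReal.ofReal_le_ofReal_iff hB] at h
  · rwa [integral_undef hi]

/-- `d ↦ κ(d,·)` is Lipschitz from `(-1,1)` with the hyperbolic distance
`|artanh d₁ - artanh d₂| = (1/2)|log((1+d₁)/(1-d₁)) - log((1+d₂)/(1-d₂))|` into `H₀`. -/
theorem stmt_12 (p : ℝ) (hp : 1 < p) :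
    ∃ C : ℝ, 0 < C ∧ ∀ d₁ ∈ Set.Ioo (-1:ℝ) 1, ∀ d₂ ∈ Set.Ioo (-1:ℝ) 1,
      Hnorm p (fun y => kappa p d₁ y - kappa p d₂ y) ≤
        C * (1 / 2 * |Real.log ((1 + d₁) / (1 - d₁)) - Real.log ((1 + d₂) / (1 - d₂))|) := by
  obtain ⟨K, hK, h⟩ := exists_lintegral_kappa_tanh_sub_le hp
  refine ⟨√K, Real.sqrt_pos.2 hK, fun d₁ hd₁ d₂ hd₂ => ?_⟩
  have hle := h (Real.artanh d₁) (Real.artanh d₂)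
  rw [Real.tanh_artanh hd₁, Real.tanh_artanh hd₂] at hle
  have hint := integral_le_of_lintegral_ofReal_le
    (MeasureTheory.ae_restrict_of_forall_mem measurableSet_Ioo fun y hy => by
      have hw : 0 < 1 - y ^ 2 := by nlinarith [hy.1, hy.2]
      simp only [Pi.zero_apply, rho]
      positivity) (by positivity) hle
  have hdist : 1 / 2 * |Real.log ((1 + d₁) / (1 - d₁)) - Real.log ((1 + d₂) / (1 - d₂))| =
      |Real.artanh d₁ - Real.artanh d₂| := by
    rw [Real.artanh_eq_half_log (Ioo_subset_Icc_self hd₁),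
      Real.artanh_eq_half_log (Ioo_subset_Icc_self hd₂), ← mul_sub, abs_mul]
    norm_num
  rw [hdist, mul_comm, ← Real.sqrt_sq_eq_abs, ← Real.sqrt_mul (sq_nonneg _)]
  exact Real.sqrt_le_sqrt hint
end
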